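/- Let A, B and C be three abelian groups. Then there exists a group S that is strongly torsion generated, has centre isomorphic to A, satisfies H_1(S) = 0, H_2(S) ≅ B and H_3(S) ≅ C, and in addition has the property that every finite-dimensional complex representation of S is trivial, i.e. every group homomorphism from S to the group of linear automorphisms of a finite-dimensional complex vector space is the trivial homomorphism. -/

import Mathlib

open CategoryTheory AlgebraicTopology

/-- The chain complex (over `ℤ`) associated to the nerve of the one-object groupoid on a
group `G`, i.e. the simplicial chain complex of the classifying space `BG`; its homology in
positive degrees is the integral group homology of `G`. -/
noncomputable def classifyingComplex (G : Type) [Group G] : ChainComplex (ModuleCat ℤ) ℕ :=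
  (alternatingFaceMapComplex (ModuleCat ℤ)).obj
    (((SimplicialObject.whiskering (Type) (ModuleCat ℤ)).obj (ModuleCat.free ℤ)).obj
      (nerve (SingleObj G)))

/-- The integral group homology `H_n(G; ℤ)` of a group `G`. -/
noncomputable def grpHomology (G : Type) [Group G] (n : ℕ) : ModuleCat ℤ :=
  (classifyingComplex G).homology n

/-- A group `G` is strongly torsion generated if for every `n ≥ 2` there is an element of
order exactly `n` whose normal closure is all of `G`. -/
def StronglyTorsionGenerated (G : Type*) [Group G] : Prop :=
  ∀ n : ℕ, 2 ≤ n → ∃ g : G, orderOf g = n ∧ Subgroup.normalClosure {g} = ⊤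


open CategoryTheory AlgebraicTopology

namespace Rz

section Cochains
variable {G H K L M : Type} [Group G] [Group H] [Group K] [Group L] [AddCommGroup M]

def Coc1 (f : G → M) : Prop := ∀ x y, f (x * y) = f x + f y
def Coc2 (f : G → G → M) : Prop :=
  ∀ x y z, f y z - f (x * y) z + f x (y * z) - f x y = 0
def Coc3 (f : G → G → G → M) : Prop :=
  ∀ x y z w, f y z w - f (x * y) z w + f x (y * z) w - f x y (z * w) + f x y z = 0
def Cob2 (f : G → G → M) : Prop := ∃ u : G → M, ∀ x y, f x y = u x + u y - u (x * y)
def Cob3 (f : G → G → G → M) : Prop :=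
  ∃ g : G → G → M, ∀ x y z, f x y z = g y z - g (x * y) z + g x (y * z) - g x y

lemma Coc1.one {f : G → M} (hf : Coc1 f) : f 1 = 0 := by
  have := hf 1 1
  simpa using this

lemma Coc1.inv {f : G → M} (hf : Coc1 f) (x : G) : f x⁻¹ = - f x := by
  have := hf x⁻¹ x
  rw [inv_mul_cancel, hf.one] at this
  exact eq_neg_of_add_eq_zero_left this.symm

lemma Coc1.comp {f : G → M} (hf : Coc1 f) (α : H →* G) : Coc1 (fun x => f (α x)) := by
  intro x y; simp [hf (α x) (α y)]

lemma Coc2.comp {f : G → G → M} (hf : Coc2 f) (α : H →* G) :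
    Coc2 (fun x y => f (α x) (α y)) := by
  intro x y z; simpa using hf (α x) (α y) (α z)

lemma Coc3.comp {f : G → G → G → M} (hf : Coc3 f) (α : H →* G) :
    Coc3 (fun x y z => f (α x) (α y) (α z)) := by
  intro x y z w; simpa using hf (α x) (α y) (α z) (α w)

lemma Cob2.comp {f : G → G → M} (hf : Cob2 f) (α : H →* G) :
    Cob2 (fun x y => f (α x) (α y)) := by
  obtain ⟨u, hu⟩ := hf
  exact ⟨fun x => u (α x), fun x y => by simp [hu]⟩

lemma Cob3.comp {f : G → G → G → M} (hf : Cob3 f) (α : H →* G) :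
    Cob3 (fun x y z => f (α x) (α y) (α z)) := by
  obtain ⟨u, hu⟩ := hf
  exact ⟨fun x y => u (α x) (α y), fun x y z => by simp [hu]⟩

/-- conjugation acts trivially in degree two -/
lemma conj2 {f : G → G → M} (hf : Coc2 f) (t : G) :
    ∃ w : G → M, ∀ x y, f (t * x * t⁻¹) (t * y * t⁻¹) = f x y + (w x + w y - w (x * y)) := by
  refine ⟨fun x => f (t * x * t⁻¹) t - f t x, fun x y => ?_⟩
  have h1 := hf t x y
  have h2 := hf (t * x * t⁻¹) t y
  have h3 := hf (t * x * t⁻¹) (t * y * t⁻¹) t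
  simp only [mul_assoc, inv_mul_cancel, mul_one, inv_mul_cancel_left] at *
  grind

lemma conj3 {f : G → G → G → M} (hf : Coc3 f) (t : G) :
    ∃ w : G → G → M, ∀ x y z, f (t * x * t⁻¹) (t * y * t⁻¹) (t * z * t⁻¹) = f x y z +
      (w y z - w (x * y) z + w x (y * z) - w x y) := by
  refine ⟨fun x y => - (f t x y - f (t * x * t⁻¹) t y + f (t * x * t⁻¹) (t * y * t⁻¹) t),
    fun x y z => ?_⟩
  have h1 := hf t x y z
  have h2 := hf (t * x * t⁻¹) t y z
  have h3 := hf (t * x * t⁻¹) (t * y * t⁻¹) t z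
  have h4 := hf (t * x * t⁻¹) (t * y * t⁻¹) (t * z * t⁻¹) t
  simp only [mul_assoc, inv_mul_cancel, mul_one, inv_mul_cancel_left] at *
  grind

def chi (F : H × K → H × K → M) (h : H) (k : K) : M := F (h, 1) (1, k) - F (1, k) (h, 1)
def PP (F : H × K → H × K → H × K → M) (h : H) (k k' : K) : M :=
  F (h, 1) (1, k) (1, k') - F (1, k) (h, 1) (1, k') + F (1, k) (1, k') (h, 1)
def QQ (F : H × K → H × K → H × K → M) (h h' : H) (k : K) : M :=
  F (h, 1) (h', 1) (1, k) - F (h, 1) (1, k) (h', 1) + F (1, k) (h, 1) (h', 1)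

lemma prod2 {F : H × K → H × K → M} (hF : Coc2 F) :
    ∃ u : H × K → M, ∀ p q, F p q = F (p.1, 1) (q.1, 1) + F (1, p.2) (1, q.2)
      + chi F p.1 q.2 + (u p + u q - u (p * q)) := by
  refine ⟨fun p => - F (1, p.2) (p.1, 1), ?_⟩
  rintro ⟨h1, k1⟩ ⟨h2, k2⟩
  have c1 := hF (1, k1) (1, k2) (h1, 1)
  have c2 := hF (1, k1) (h1, 1) (1, k2)
  have c3 := hF (1, k1 * k2) (h1, 1) (h2, 1)
  have c4 := hF (h1, k1) (1, k2) (h2, 1)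
  simp only [chi, Prod.mk_mul_mk, one_mul, mul_one] at *
  grind

lemma chi_left {F : H × K → H × K → M} (hF : Coc2 F) (k : K) : Coc1 (fun h => chi F h k) := by
  intro h h'
  have c1 := hF (h, 1) (h', 1) (1, k)
  have c2 := hF (h, 1) (1, k) (h', 1)
  have c3 := hF (1, k) (h, 1) (h', 1)
  simp only [chi, Prod.mk_mul_mk, one_mul, mul_one] at *
  grind

lemma prod3 {F : H × K → H × K → H × K → M} (hF : Coc3 F) :
    ∃ g : H × K → H × K → M, ∀ p q r, F p q r = F (p.1, 1) (q.1, 1) (r.1, 1)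
      + F (1, p.2) (1, q.2) (1, r.2) + PP F p.1 q.2 r.2 + QQ F p.1 q.1 r.2
      + (g q r - g (p * q) r + g p (q * r) - g p q) := by
  refine ⟨fun p q => F (1, p.2) (1, q.2) (p.1, 1) - F (1, p.2) (p.1, 1) (1, q.2)
    - F (1, p.2 * q.2) (p.1, 1) (q.1, 1) + F p (1, q.2) (q.1, 1), ?_⟩
  rintro ⟨h1, k1⟩ ⟨h2, k2⟩ ⟨h3, k3⟩
  have c1 := hF (1, k1) (1, k2) (1, k3) (h1, 1)
  have c2 := hF (1, k1) (1, k2) (h1, 1) (1, k3)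
  have c3 := hF (1, k1) (h1, 1) (1, k2) (1, k3)
  have c4 := hF (1, k1 * k2) (1, k3) (h1, 1) (h2, 1)
  have c5 := hF (1, k1 * k2) (h1, 1) (1, k3) (h2, 1)
  have c6 := hF (1, k1 * k2) (h1, 1) (h2, 1) (1, k3)
  have c7 := hF (1, k1 * k2 * k3) (h1, 1) (h2, 1) (h3, 1)
  have c8 := hF (h1, k1) (1, k2) (1, k3) (h2, 1)
  have c9 := hF (h1, k1) (1, k2) (h2, 1) (1, k3)
  have c10 := hF (h1, k1) (1, k2 * k3) (h2, 1) (h3, 1)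
  have c11 := hF (h1, k1) (h2, k2) (1, k3) (h3, 1)
  simp only [PP, QQ, Prod.mk_mul_mk, one_mul, mul_one, mul_assoc] at *
  linear_combination (norm := abel) -c1 + c2 - c3 - c4 + c5 - c6 - c7 - c8 + c9 + c10 - c11

lemma QQ_coc {F : H × K → H × K → H × K → M} (hF : Coc3 F) (k : K) :
    Coc2 (fun h h' => QQ F h h' k) := by
  intro x y z
  have c1 := hF (x, 1) (y, 1) (z, 1) (1, k)
  have c2 := hF (x, 1) (y, 1) (1, k) (z, 1)
  have c3 := hF (x, 1) (1, k) (y, 1) (z, 1)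
  have c4 := hF (1, k) (x, 1) (y, 1) (z, 1)
  simp only [QQ, Prod.mk_mul_mk, one_mul, mul_one] at *
  grind

lemma PP_coc {F : H × K → H × K → H × K → M} (hF : Coc3 F) (h : H) :
    Coc2 (fun k k' => PP F h k k') := by
  intro x y z
  have c1 := hF (1, x) (1, y) (1, z) (h, 1)
  have c2 := hF (1, x) (1, y) (h, 1) (1, z)
  have c3 := hF (1, x) (h, 1) (1, y) (1, z)
  have c4 := hF (h, 1) (1, x) (1, y) (1, z)
  simp only [PP, Prod.mk_mul_mk, one_mul, mul_one] at *
  grind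

lemma PQ_rel {F : H × K → H × K → H × K → M} (hF : Coc3 F) (h h' : H) (k k' : K) :
    PP F h k k' + PP F h' k k' - PP F (h * h') k k'
      + (QQ F h h' k + QQ F h h' k' - QQ F h h' (k * k')) = 0 := by
  have c1 := hF (h, 1) (h', 1) (1, k) (1, k')
  have c2 := hF (h, 1) (1, k) (h', 1) (1, k')
  have c3 := hF (h, 1) (1, k) (1, k') (h', 1)
  have c4 := hF (1, k) (h, 1) (h', 1) (1, k')
  have c5 := hF (1, k) (h, 1) (1, k') (h', 1)
  have c6 := hF (1, k) (1, k') (h, 1) (h', 1)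
  simp only [PP, QQ, Prod.mk_mul_mk, one_mul, mul_one, mul_assoc] at *
  grind

end Cochains

section Mitotic
variable {G H K L : Type} [Group G] [Group H] [Group K] [Group L]

def Mit (ι : H →* K) : Prop :=
  ∃ (φ : H →* K) (t : K), (∀ h h', Commute (ι h) (φ h')) ∧ ∀ h, t * φ h * t⁻¹ = ι h * φ h

def Z1 (M : Type) [AddCommGroup M] (α : H →* K) : Prop :=
  ∀ f : K → M, Coc1 f → ∀ h, f (α h) = 0
def Z2 (M : Type) [AddCommGroup M] (α : H →* K) : Prop :=
  ∀ f : K → K → M, Coc2 f → Cob2 (fun x y => f (α x) (α y))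
def Z3 (M : Type) [AddCommGroup M] (α : H →* K) : Prop :=
  ∀ f : K → K → K → M, Coc3 f → Cob3 (fun x y z => f (α x) (α y) (α z))

variable {M : Type} [AddCommGroup M]

lemma Mit.z1 {ι : H →* K} (h : Mit ι) : Z1 M ι := by
  obtain ⟨φ, t, hc, ht⟩ := h
  intro f hf x
  have := congrArg f (ht x)
  rw [hf, hf, hf, hf.inv] at this
  have h2 : f (ι x) + f (φ x) = f (φ x) := by rw [← this]; abel
  simpa using h2

lemma Mit.z2 {ι : H →* K} {ι' : K →* L} (h1 : Z1 M ι) (h : Mit ι') : Z2 M (ι'.comp ι) := by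
  obtain ⟨φ, t, hc, ht⟩ := h
  intro f hf
  let μ := ι'.noncommCoprod φ hc
  have hF := hf.comp μ
  obtain ⟨u, hu⟩ := prod2 hF
  obtain ⟨w, hw⟩ := conj2 hf t
  refine ⟨fun x => w (φ (ι x)) - u (ι x, ι x), fun x y => ?_⟩
  have e1 := hu (ι x, ι x) (ι y, ι y)
  have e2 := h1 _ (chi_left hF (ι y)) x
  have e3 := hw (φ (ι x)) (φ (ι y))
  simp only [ht, μ, MonoidHom.noncommCoprod_apply, map_one, mul_one, one_mul, MonoidHom.comp_apply,
    Prod.mk_mul_mk, ← map_mul] at *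
  grind

lemma mix3 {H0 : Type} [Group H0] {F : H × K → H × K → H × K → M} (hF : Coc3 F) (a : H0 →* H)
    (ha : Z1 M a) (hQ : ∀ k, Cob2 (fun x y => QQ F x y k)) :
    ∃ V : H0 × K → H0 × K → M, ∀ p q r, PP F (a p.1) q.2 r.2 + QQ F (a p.1) (a q.1) r.2 =
      V q r - V (p * q) r + V p (q * r) - V p q := by
  choose v hv using hQ
  refine ⟨fun p q => v q.2 (a p.1), ?_⟩
  have hom : ∀ k k', Coc1 (fun h => PP F h k k' + (v k h + v k' h - v (k * k') h)) := by
    intro k k' h h'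
    have c := PQ_rel hF h h' k k'
    simp only [hv] at c
    grind
  rintro ⟨h1, k1⟩ ⟨h2, k2⟩ ⟨h3, k3⟩
  have e := ha _ (hom k2 k3) h1
  have e2 := hv k3 (a h1) (a h2)
  simp only [Prod.mk_mul_mk, map_mul] at *
  grind

lemma Mit.z3 {α : G →* H} {ι : H →* K} {ι' : K →* L} (h1 : Z1 M α) (h2 : Z2 M ι) (h : Mit ι') :
    Z3 M ((ι'.comp ι).comp α) := by
  obtain ⟨φ, t, hc, ht⟩ := h
  intro f hf
  let μ := ι'.noncommCoprod φ hc
  have hF := hf.comp μ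
  obtain ⟨u, hu⟩ := prod3 hF
  have hF' := hF.comp (MonoidHom.prodMap ι (MonoidHom.id K))
  have hQ : ∀ k, Cob2 (fun x y => QQ (fun p q r : H × K => f (μ (ι.prodMap (MonoidHom.id K) p))
     (μ (ι.prodMap (MonoidHom.id K) q)) (μ (ι.prodMap (MonoidHom.id K) r))) x y k) := by
    intro k
    have := h2 _ (QQ_coc hF k)
    simpa [QQ] using this
  obtain ⟨V, hV⟩ := mix3 hF' α h1 hQ
  obtain ⟨w, hw⟩ := conj3 hf t
  refine ⟨fun x y => w (φ (ι (α x))) (φ (ι (α y))) - u (ι (α x), ι (α x)) (ι (α y), ι (α y))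
    - V (x, ι (α x)) (y, ι (α y)), fun x y z => ?_⟩
  have e1 := hu (ι (α x), ι (α x)) (ι (α y), ι (α y)) (ι (α z), ι (α z))
  have e2 := hV (x, ι (α x)) (y, ι (α y)) (z, ι (α z))
  have e3 := hw (φ (ι (α x))) (φ (ι (α y))) (φ (ι (α z)))
  simp only [PP, QQ, MonoidHom.prodMap_def, MonoidHom.prod_apply, MonoidHom.comp_apply, ht, μ, MonoidHom.noncommCoprod_apply,
    MonoidHom.coe_fst, MonoidHom.coe_snd, MonoidHom.id_apply, map_one, mul_one, one_mul,
    Prod.mk_mul_mk, ← map_mul] at *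
  grind

end Mitotic
end Rz


open CategoryTheory AlgebraicTopology

namespace Rz

abbrev TT : Type := AddCircle (1 : ℚ)

lemma exists_char {M : Type} [AddCommGroup M] {m : M} (hm : m ≠ 0) : ∃ c : M →+ TT, c m ≠ 0 :=
  CharacterModule.exists_character_apply_ne_zero_of_ne_zero (A := M) hm

lemma char_ext {M N : Type} [AddCommGroup M] [AddCommGroup N] (i : M →+ N)
    (hi : Function.Injective i) (c : M →+ TT) : ∃ c' : N →+ TT, ∀ m, c' (i m) = c m := by
  obtain ⟨c', hc'⟩ := CharacterModule.dual_surjective_of_injective (R := ℤ)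
    i.toIntLinearMap hi c
  refine ⟨c', fun m => ?_⟩
  rw [← hc']; rfl

lemma char_factor {M N : Type} [AddCommGroup M] [AddCommGroup N] (d : M →+ N)
    (f : M →+ TT) (h : ∀ a, d a = 0 → f a = 0) : ∃ u : N →+ TT, ∀ a, f a = u (d a) := by
  have hle : d.ker ≤ f.ker := fun a ha => h a ha
  obtain ⟨u, hu⟩ := char_ext (QuotientAddGroup.kerLift d) (QuotientAddGroup.kerLift_injective d)
    (QuotientAddGroup.lift d.ker f hle)
  refine ⟨u, fun a => ?_⟩
  have := hu (a : M ⧸ d.ker)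
  simpa using this.symm

noncomputable def LL {Y M : Type} [AddCommGroup M] (u : Y → M) : (Y →₀ ℤ) →+ M :=
  Finsupp.liftAddHom (fun y => zmultiplesHom M (u y))

@[simp] lemma LL_single {Y M : Type} [AddCommGroup M] (u : Y → M) (y : Y) (n : ℤ) :
    LL u (Finsupp.single y n) = n • u y := by simp [LL]

lemma lim_aux {X Y : Type} (d : X → (Y →₀ ℤ)) (f : X → TT)
    (h : ∀ F : Finset X, ∃ (X' Y' : Type) (a : X' → X) (b : Y' → Y) (d' : X' → (Y' →₀ ℤ))
      (u : Y' → TT), Function.Injective b ∧ (∀ x ∈ F, ∃ x', a x' = x) ∧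
      (∀ x', d (a x') = Finsupp.mapDomain b (d' x')) ∧ (∀ x', f (a x') = LL u (d' x'))) :
    ∃ u : Y → TT, ∀ x, f x = LL u (d x) := by
  obtain ⟨u, hu⟩ := char_factor (LL d) (LL f) (by
    intro c hc
    obtain ⟨X', Y', a, b, d', u, hb, hF, hd, hf⟩ := h c.support
    obtain ⟨c', hc'⟩ : ∃ c' : X' →₀ ℤ, Finsupp.mapDomain a c' = c := by
      rcases c.support.eq_empty_or_nonempty with h0 | ⟨x0, hx0⟩
      · exact ⟨0, by rw [Finsupp.support_eq_empty.mp h0]; simp⟩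
      · obtain ⟨x0', -⟩ := hF x0 hx0
        have : Nonempty X' := ⟨x0'⟩
        refine ⟨Finsupp.mapDomain (Function.invFun a) c, ?_⟩
        rw [← Finsupp.mapDomain_comp]
        conv_rhs => rw [← Finsupp.mapDomain_id (v := c)]
        exact Finsupp.mapDomain_congr fun x hx => Function.invFun_eq (hF x hx)
    subst hc'
    have h1 : ∀ c : X' →₀ ℤ, LL d (Finsupp.mapDomain a c) = Finsupp.mapDomain b (LL d' c) := by
      intro c
      have : (LL d).comp (Finsupp.mapDomain.addMonoidHom a) =
          (Finsupp.mapDomain.addMonoidHom b).comp (LL d') := by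
        ext x; simp [hd]
      exact DFunLike.congr_fun this c
    have h2 : ∀ c : X' →₀ ℤ, LL f (Finsupp.mapDomain a c) = LL u (LL d' c) := by
      intro c
      have : (LL f).comp (Finsupp.mapDomain.addMonoidHom a) = (LL u).comp (LL d') := by
        ext x; simp [hf]
      exact DFunLike.congr_fun this c
    rw [h1] at hc
    have h3 : LL d' c' = 0 := by
      apply Finsupp.mapDomain_injective hb
      rw [hc, Finsupp.mapDomain_zero]
    rw [h2, h3, map_zero])
  refine ⟨fun y => u (Finsupp.single y 1), fun x => ?_⟩
  have h1 := hu (Finsupp.single x 1)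
  have h2 : u = LL (fun y => u (Finsupp.single y 1)) := by ext y; simp
  rw [LL_single, LL_single, one_smul, one_smul] at h1
  rw [h1]
  exact DFunLike.congr_fun h2 _

section Binate
variable {G H K L : Type} [Group G] [Group H] [Group K] [Group L]

def Chain (G : Type) [Group G] : ℕ → ∀ (H : Type) [Group H], (H →* G) → Prop
  | 0, _, _, _ => True
  | r + 1, H, _, α => ∃ (K : Type) (_ : Group K) (ι : H →* K) (β : K →* G),
      α = β.comp ι ∧ Mit ι ∧ Chain G r K β

def Binate (G : Type) [Group G] : Prop :=
  ∀ F : Finset G, ∃ (H : Type) (_ : Group H) (α : H →* G), Function.Injective α ∧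
    (∀ x ∈ F, ∃ h, α h = x) ∧ Chain G 4 H α

def A1 (G : Type) [Group G] : Prop := ∀ f : G → TT, Coc1 f → ∀ x, f x = 0
def A2 (G : Type) [Group G] : Prop := ∀ f : G → G → TT, Coc2 f → Cob2 f
def A3 (G : Type) [Group G] : Prop := ∀ f : G → G → G → TT, Coc3 f → Cob3 f

variable {M : Type} [AddCommGroup M]

lemma Chain.z1 {r : ℕ} {α : H →* G} (h : Chain G (r + 1) H α) : Z1 M α := by
  obtain ⟨K, _, ι, β, rfl, hι, _⟩ := h
  intro f hf x
  exact hι.z1 _ (hf.comp β) x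

lemma Chain.z2 {r : ℕ} {α : H →* G} (h : Chain G (r + 2) H α) : Z2 M α := by
  obtain ⟨K, _, ι, β, rfl, hι, K', _, ι', β', rfl, hι', _⟩ := h
  intro f hf
  exact Mit.z2 hι.z1 hι' _ (hf.comp β')

lemma Chain.z3 {r : ℕ} {α : H →* G} (h : Chain G (r + 4) H α) : Z3 M α := by
  obtain ⟨K1, _, ι1, β1, rfl, h1, K2, _, ι2, β2, rfl, h2, K3, _, ι3, β3, rfl, h3,
    K4, _, ι4, β4, rfl, h4, _⟩ := h
  intro f hf
  exact Mit.z3 h1.z1 (Mit.z2 h2.z1 h3) h4 _ (hf.comp β4)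

lemma Binate.a1 (h : Binate G) : A1 G := by
  intro f hf x
  obtain ⟨H, _, α, hα, hF, hc⟩ := h {x}
  obtain ⟨y, rfl⟩ := hF x (by simp)
  exact hc.z1 f hf y

noncomputable def D2 (p : G × G) : G →₀ ℤ :=
  Finsupp.single p.1 1 + Finsupp.single p.2 1 - Finsupp.single (p.1 * p.2) 1
noncomputable def D3 (p : G × G × G) : G × G →₀ ℤ :=
  Finsupp.single (p.2.1, p.2.2) 1 - Finsupp.single (p.1 * p.2.1, p.2.2) 1
    + Finsupp.single (p.1, p.2.1 * p.2.2) 1 - Finsupp.single (p.1, p.2.1) 1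

lemma Binate.a2 (h : Binate G) : A2 G := by
  classical
  intro f hf
  obtain ⟨u, hu⟩ := lim_aux D2 (fun p : G × G => f p.1 p.2) (by
    intro F
    obtain ⟨H, _, α, hα, hF, hc⟩ := h (F.image Prod.fst ∪ F.image Prod.snd)
    obtain ⟨u, hu⟩ := hc.z2 f hf
    refine ⟨H × H, H, Prod.map α α, α, D2, u, hα, ?_, ?_, ?_⟩
    · intro x hx
      obtain ⟨a, ha⟩ := hF x.1 (by grind)
      obtain ⟨b, hb⟩ := hF x.2 (by grind)
      exact ⟨(a, b), by simp [ha, hb]⟩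
    · intro x
      simp [D2, sub_eq_add_neg, ← Finsupp.single_neg, Finsupp.mapDomain_add, Finsupp.mapDomain_single]
    · intro x
      simp [D2, hu])
  exact ⟨u, fun x y => by simpa [D2] using hu (x, y)⟩

lemma Binate.a3 (h : Binate G) : A3 G := by
  classical
  intro f hf
  obtain ⟨u, hu⟩ := lim_aux D3 (fun p : G × G × G => f p.1 p.2.1 p.2.2) (by
    intro F
    obtain ⟨H, _, α, hα, hF, hc⟩ := h (F.image Prod.fst ∪ F.image (fun p => p.2.1)
      ∪ F.image (fun p => p.2.2))
    obtain ⟨u, hu⟩ := hc.z3 f hf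
    refine ⟨H × H × H, H × H, Prod.map α (Prod.map α α), Prod.map α α, D3,
      fun p => u p.1 p.2, hα.prodMap hα, ?_, ?_, ?_⟩
    · intro x hx
      obtain ⟨a, ha⟩ := hF x.1 (by grind)
      obtain ⟨b, hb⟩ := hF x.2.1 (by grind)
      obtain ⟨c, hc⟩ := hF x.2.2 (by grind)
      exact ⟨(a, b, c), by simp [ha, hb, hc]⟩
    · rintro ⟨x, y, z⟩
      simp [D3, sub_eq_add_neg, ← Finsupp.single_neg, Finsupp.mapDomain_add, Finsupp.mapDomain_single]
    · intro x
      simp [D3, hu])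
  exact ⟨fun x y => u (x, y), fun x y z => by simpa [D3] using hu (x, y, z)⟩

lemma A1.gen (h : A1 G) {f : G → M} (hf : Coc1 f) (x : G) : f x = 0 := by
  by_contra hx
  obtain ⟨c, hc⟩ := exists_char hx
  exact hc (h (fun x => c (f x)) (fun x y => by simp [hf x y]) x)

lemma A1.hom {N : Type} [CommGroup N] (h : A1 G) (f : G →* N) (x : G) : f x = 1 := by
  have := h.gen (M := Additive N) (f := fun x => Additive.ofMul (f x)) (fun x y => by simp) x
  simpa using this

lemma A1.perfect (h : A1 G) : commutator G = ⊤ := by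
  rw [eq_top_iff]
  intro x _
  have := h.hom (Abelianization.of) x
  rwa [← MonoidHom.mem_ker, Abelianization.ker_of] at this

end Binate
end Rz


open CategoryTheory AlgebraicTopology

namespace Rz

section Quot
variable {G H K E Q M : Type} [Group G] [Group H] [Group K] [Group E] [Group Q] [AddCommGroup M]

lemma Coc2.one_left {f : G → G → M} (hf : Coc2 f) (x : G) : f 1 x = f 1 1 := by
  have := hf 1 1 x
  simp only [one_mul] at this
  grind

lemma Coc2.one_right {f : G → G → M} (hf : Coc2 f) (x : G) : f x 1 = f 1 1 := by
  have := hf x 1 1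
  simp only [mul_one] at this
  grind

def U2 (S C : Type) [Group S] [AddCommGroup C] (κ : S → S → C) : Prop :=
  Coc2 κ ∧ (∀ f : S → S → TT, Coc2 f → ∃ c : C →+ TT, Cob2 (fun x y => f x y - c (κ x y))) ∧
    ∀ c : C →+ TT, Cob2 (fun x y => c (κ x y)) → c = 0

def U3 (S C : Type) [Group S] [AddCommGroup C] (κ : S → S → S → C) : Prop :=
  Coc3 κ ∧ (∀ f : S → S → S → TT, Coc3 f →
    ∃ c : C →+ TT, Cob3 (fun x y z => f x y z - c (κ x y z))) ∧
    ∀ c : C →+ TT, Cob3 (fun x y z => c (κ x y z)) → c = 0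

lemma A1.prod (h1 : A1 H) (h2 : A1 K) : A1 (H × K) := by
  rintro f hf ⟨h, k⟩
  have e := hf (h, 1) (1, k)
  have e1 := h1 _ (hf.comp (MonoidHom.inl H K)) h
  have e2 := h2 _ (hf.comp (MonoidHom.inr H K)) k
  simp at e e1 e2
  rw [e, e1, e2, add_zero]

lemma A1.prodU2 {C : Type} [AddCommGroup C] {κ : H → H → C} (h1 : A1 H) (h2 : A2 K)
    (hκ : U2 H C κ) : U2 (H × K) C (fun p q => κ p.1 q.1) := by
  refine ⟨hκ.1.comp (MonoidHom.fst H K), ?_, ?_⟩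
  · intro F hF
    obtain ⟨u, hu⟩ := prod2 hF
    obtain ⟨c, v, hv⟩ := hκ.2.1 _ (hF.comp (MonoidHom.inl H K))
    obtain ⟨w, hw⟩ := h2 _ (hF.comp (MonoidHom.inr H K))
    refine ⟨c, fun p => u p + v p.1 + w p.2, fun p q => ?_⟩
    have e1 := hu p q
    have e2 := hv p.1 q.1
    have e3 := hw p.2 q.2
    have e4 := h1 _ (chi_left hF q.2) p.1
    simp only [MonoidHom.inl_apply, MonoidHom.inr_apply, Prod.fst_mul, Prod.snd_mul] at *
    grind
  · intro c hc
    refine hκ.2.2 c ?_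
    simpa using hc.comp (MonoidHom.inl H K)

lemma A1.prodU3 {C : Type} [AddCommGroup C] {κ : K → K → K → C} (h1 : A1 K)
    (h2 : A2 K) (h3 : A3 H) (hκ : U3 K C κ) :
    U3 (H × K) C (fun p q r => κ p.2 q.2 r.2) := by
  refine ⟨hκ.1.comp (MonoidHom.snd H K), ?_, ?_⟩
  · intro F hF
    obtain ⟨u, hu⟩ := prod3 hF
    obtain ⟨c, v, hv⟩ := hκ.2.1 _ (hF.comp (MonoidHom.inr H K))
    obtain ⟨w, hw⟩ := h3 _ (hF.comp (MonoidHom.inl H K))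
    have hP : ∀ h, Cob2 (fun k k' => PP F h k k') := fun h => h2 _ (PP_coc hF h)
    choose z hz using hP
    have hom : ∀ h h', Coc1 (fun k => QQ F h h' k + (z h k + z h' k - z (h * h') k)) := by
      intro h h' k k'
      have c := PQ_rel hF h h' k k'
      simp only [hz] at c
      grind
    refine ⟨c, fun p q => u p q + w p.1 q.1 + v p.2 q.2 - z p.1 q.2, fun p q r => ?_⟩
    have e1 := hu p q r
    have e2 := hv p.2 q.2 r.2
    have e3 := hw p.1 q.1 r.1
    have e4 := h1 _ (hom p.1 q.1) r.2
    have e5 := hz p.1 q.2 r.2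
    simp only [MonoidHom.inl_apply, MonoidHom.inr_apply, Prod.fst_mul, Prod.snd_mul] at *
    grind
  · intro c hc
    refine hκ.2.2 c ?_
    simpa using hc.comp (MonoidHom.inr H K)

lemma norm3 {f : G → G → G → M} (hf : Coc3 f) : ∃ f' : G → G → G → M, Coc3 f' ∧
    Cob3 (fun x y z => f x y z - f' x y z) ∧ (∀ x y, f' 1 x y = 0) ∧ (∀ x y, f' x 1 y = 0) ∧
    (∀ x y, f' x y 1 = 0) := by
  let g : G → G → M := fun x y => f 1 1 y - f x 1 1
  refine ⟨fun x y z => f x y z - (g y z - g (x * y) z + g x (y * z) - g x y), ?_, ⟨g, ?_⟩,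
    ?_, ?_, ?_⟩
  · intro x y z w
    have := hf x y z w
    simp only [mul_assoc]
    linear_combination (norm := abel) this
  · intro x y z; simp
  · intro x y
    have a1 := hf 1 1 x y
    have a2 := hf 1 1 1 x
    have a3 := hf 1 1 1 1
    have a4 := hf x 1 1 1
    have a5 := hf 1 1 1 y
    have a6 := hf 1 1 1 (x * y)
    simp only [g, one_mul, mul_one] at *
    grind
  · intro x y
    have a1 := hf x 1 1 y
    have a2 := hf 1 1 1 x
    have a3 := hf 1 1 1 1
    have a4 := hf x 1 1 1
    have a5 := hf 1 1 1 y
    have a6 := hf 1 1 1 (x * y)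
    simp only [g, one_mul, mul_one] at *
    grind
  · intro x y
    have a1 := hf x y 1 1
    have a2 := hf y 1 1 1
    have a3 := hf 1 1 1 1
    have a4 := hf x 1 1 1
    have a6 := hf (x * y) 1 1 1
    simp only [g, one_mul, mul_one] at *
    grind

lemma Cob3.of_norm {f f' : G → G → G → M} (h : Cob3 (fun x y z => f x y z - f' x y z))
    (h' : Cob3 f') : Cob3 f := by
  obtain ⟨u, hu⟩ := h
  obtain ⟨v, hv⟩ := h'
  refine ⟨fun x y => u x y + v x y, fun x y z => ?_⟩
  have e1 := hu x y z
  have e2 := hv x y z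
  simp only at *
  grind

/-- Descent of a 2-cochain along a surjection. -/
lemma descent {π : E →* Q} (hπ : Function.Surjective π) {f : Q → Q → Q → M}
    (f1 : ∀ x y, f 1 x y = 0) (f2 : ∀ x y, f x 1 y = 0) (f3 : ∀ x y, f x y 1 = 0)
    {g : E → E → M}
    (hg : ∀ x y z, f (π x) (π y) (π z) = g y z - g (x * y) z + g x (y * z) - g x y)
    {u : E → M} (hu : ∀ n n', π n = 1 → π n' = 1 → g n n' = u n + u n' - u (n * n'))
    (hcomm : ∀ g' : E → E → M,
      (∀ x y z, f (π x) (π y) (π z) = g' y z - g' (x * y) z + g' x (y * z) - g' x y) →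
      (∀ n e, π n = 1 → g' n e = 0) → (∀ n e e', π n = 1 → g' (n * e) e' = g' e e') →
      ∀ e n, π n = 1 → g' e n = 0) : Cob3 f := by
  classical
  -- normalise `g`
  wlog h0 : g 1 1 = 0 generalizing g u
  · refine this (g := fun x y => g x y - g 1 1) (u := fun x => u x - g 1 1) ?_ ?_ ?_
    · intro x y z; rw [hg]; abel
    · intro n n' hn hn'; rw [hu n n' hn hn']; abel
    · simp
  have g1 : ∀ e, g e 1 = 0 := by
    intro e
    have := hg e 1 1
    simp only [map_one, f3, mul_one] at this
    grind
  have g2 : ∀ e, g 1 e = 0 := by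
    intro e
    have := hg 1 1 e
    simp only [map_one, f1, one_mul] at this
    grind
  obtain ⟨s0, hs0⟩ := hπ.hasRightInverse
  let s : Q → E := fun x => if x = 1 then 1 else s0 x
  have hs : ∀ x, π (s x) = x := by
    intro x
    by_cases hx : x = 1
    · simp [s, hx]
    · simp [s, hx, hs0 x]
  have s1 : s 1 = 1 := by simp [s]
  let ν : E → E := fun e => e * (s (π e))⁻¹
  have hν : ∀ e, π (ν e) = 1 := by intro e; simp [ν, hs]
  have hν2 : ∀ e, ν e * s (π e) = e := by intro e; simp [ν]
  have hνn : ∀ n e, π n = 1 → ν (n * e) = n * ν e := by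
    intro n e hn; simp [ν, hn, mul_assoc]
  have hν1 : ∀ n, π n = 1 → ν n = n := by intro n hn; simp [ν, hn, s1]
  let u' : E → M := fun e => u (ν e) - g (ν e) (s (π e))
  let g' : E → E → M := fun x y => g x y - (u' x + u' y - u' (x * y))
  have hg' : ∀ x y z, f (π x) (π y) (π z) = g' y z - g' (x * y) z + g' x (y * z) - g' x y := by
    intro x y z
    rw [hg]
    simp only [g', mul_assoc]
    abel
  have k1 : ∀ n e, π n = 1 → g' n e = 0 := by
    intro n e hn
    have c := hg n (ν e) (s (π e))
    rw [hn, hν, f1, hν2] at c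
    have c2 := hu n (ν e) hn (hν e)
    simp only [g', u', hνn n e hn, hν1 n hn, hn, s1, g1, map_mul, one_mul]
    grind
  have k2 : ∀ n e e', π n = 1 → g' (n * e) e' = g' e e' := by
    intro n e e' hn
    have c := hg' n e e'
    rw [hn, f1, k1 n _ hn, k1 n _ hn] at c
    grind
  have k3 := hcomm g' hg' k1 k2
  have k4 : ∀ n e e', π n = 1 → g' e (n * e') = g' e e' := by
    intro n e e' hn
    have c := hg' e n e'
    rw [hn, f2, k1 n _ hn, k3 e n hn] at c
    have c2 := k2 (e * n * e⁻¹) e e' (by simp [hn])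
    simp only [inv_mul_cancel_right] at c2
    grind
  refine ⟨fun x y => g' (s x) (s y), fun x y z => ?_⟩
  have c := hg' (s x) (s y) (s z)
  have c1 : g' (s x * s y) (s z) = g' (s (x * y)) (s z) := by
    have := k2 (ν (s x * s y)) (s (π (s x * s y))) (s z) (hν _)
    rwa [hν2, map_mul, hs, hs] at this
  have c2 : g' (s x) (s y * s z) = g' (s x) (s (y * z)) := by
    have := k4 (ν (s y * s z)) (s x) (s (π (s y * s z))) (hν _)
    rwa [hν2, map_mul, hs, hs] at this
  rw [hs, hs, hs, c1, c2] at c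
  exact c

lemma descent_comm_ker {π : E →* Q} (hN : A1 π.ker) {f : Q → Q → Q → TT}
    (f3 : ∀ x y, f x y 1 = 0) (g' : E → E → TT)
    (hg' : ∀ x y z, f (π x) (π y) (π z) = g' y z - g' (x * y) z + g' x (y * z) - g' x y)
    (k1 : ∀ n e, π n = 1 → g' n e = 0) (k2 : ∀ n e e', π n = 1 → g' (n * e) e' = g' e e')
    (e n : E) (hn : π n = 1) : g' e n = 0 := by
  refine hN (fun n => g' e n) ?_ ⟨n, hn⟩
  rintro ⟨n, hn⟩ ⟨n', hn'⟩
  rw [MonoidHom.mem_ker] at hn hn'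
  have c := hg' e n n'
  have c2 := k2 (e * n * e⁻¹) e n' (by simp [hn])
  simp only [inv_mul_cancel_right] at c2
  rw [hn', f3, k1 n n' hn, c2] at c
  simp only [Subgroup.coe_mul]
  grind

@[ext] structure Tw (B : Type) where
  a : TT
  b : B

/-- Symmetric 2-cocycles with divisible values split. -/
lemma symm_split {B : Type} [CommGroup B] {f : B → B → TT} (hf : Coc2 f)
    (hs : ∀ x y, f x y = f y x) : Cob2 f := by
  let i1 : Add (Tw B) := ⟨fun p q => ⟨p.a + q.a + f p.b q.b, p.b * q.b⟩⟩
  let i2 : Zero (Tw B) := ⟨⟨- f 1 1, 1⟩⟩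
  let i3 : Neg (Tw B) := ⟨fun p => ⟨- p.a - f p.b⁻¹ p.b - f 1 1, p.b⁻¹⟩⟩
  have add_def : ∀ p q : Tw B, p + q = ⟨p.a + q.a + f p.b q.b, p.b * q.b⟩ := fun _ _ => rfl
  have zero_def : (0 : Tw B) = ⟨- f 1 1, 1⟩ := rfl
  have neg_def : ∀ p : Tw B, - p = ⟨- p.a - f p.b⁻¹ p.b - f 1 1, p.b⁻¹⟩ := fun _ => rfl
  let i4 : AddGroup (Tw B) := AddGroup.ofLeftAxioms
    (by
      rintro ⟨a, x⟩ ⟨b, y⟩ ⟨c, z⟩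
      have := hf x y z
      simp only [add_def, mul_assoc, Tw.mk.injEq, and_true]
      grind)
    (by
      rintro ⟨a, x⟩
      simp only [add_def, zero_def, one_mul, hf.one_left x]
      simp)
    (by
      rintro ⟨a, x⟩
      simp only [add_def, zero_def, neg_def, inv_mul_cancel, Tw.mk.injEq, and_true]
      abel)
  let i5 : AddCommGroup (Tw B) := { i4 with
    add_comm := by
      rintro ⟨a, x⟩ ⟨b, y⟩
      refine (add_def _ _).trans (Eq.trans ?_ (add_def _ _).symm)
      simp only [hs x y, mul_comm x y, add_comm a b] }
  let i : TT →+ Tw B := AddMonoidHom.mk' (fun a => ⟨a - f 1 1, 1⟩) (by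
    intro a b
    refine Eq.trans ?_ (add_def _ _).symm
    simp only [one_mul, Tw.mk.injEq, and_true]
    abel)
  have hi : Function.Injective i := by
    intro a b hab
    have := congrArg Tw.a hab
    simpa [i] using this
  obtain ⟨c, hc⟩ := char_ext i hi (AddMonoidHom.id TT)
  refine ⟨fun b => c ⟨0, b⟩, fun x y => ?_⟩
  have e1 : (⟨0, x⟩ : Tw B) + ⟨0, y⟩ = i (f x y) + ⟨0, x * y⟩ := by
    refine (add_def _ _).trans (Eq.trans ?_ (add_def _ _).symm)
    simp [i, hf.one_left]
  have e2 := congrArg c e1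
  rw [map_add, map_add, hc] at e2
  simp only [AddMonoidHom.id_apply] at e2
  rw [e2]; abel

/-- Quotient by a central subgroup, degree three. -/
lemma central_a3 {B : Type} [AddCommGroup B] {π : E →* Q} (hπ : Function.Surjective π)
    (j : Multiplicative B →* E) (hj : ∀ b e, Commute (j b) e)
    (hker : ∀ e, π e = 1 ↔ ∃ b, j b = e) (hj1 : Function.Injective j) (h1 : A1 E) (h3 : A3 E) : A3 Q := by
  intro f hf
  obtain ⟨f', hf', hff, f1, f2, f3⟩ := norm3 hf
  refine hff.of_norm ?_
  obtain ⟨g, hg⟩ := h3 _ (hf'.comp π)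
  simp only at hg
  have pj : ∀ b, π (j b) = 1 := fun b => (hker _).2 ⟨b, rfl⟩
  have hsym : ∀ b e, g (j b) e = g e (j b) := by
    intro b e
    have hom : Coc1 (fun e => g (j b) e - g e (j b)) := by
      intro x y
      have c1 := hg (j b) x y
      have c2 := hg x (j b) y
      have c3 := hg x y (j b)
      simp only [pj, f1, f2, f3, (hj b x).eq, (hj b y).eq] at *
      grind
    exact sub_eq_zero.mp (h1 _ hom e)
  have hcoc : Coc2 (fun b b' : Multiplicative B => g (j b) (j b')) := by
    intro x y z
    have := hg (j x) (j y) (j z)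
    simp only [pj, f1, map_mul] at *
    exact this.symm
  obtain ⟨u, hu⟩ := symm_split hcoc (fun x y => hsym x (j y))
  refine descent hπ f1 f2 f3 hg (u := fun e => u (Function.invFun j e)) ?_ ?_
  · intro n n' hn hn'
    obtain ⟨b, rfl⟩ := (hker n).1 hn
    obtain ⟨b', rfl⟩ := (hker n').1 hn'
    rw [← map_mul]
    simp only [Function.leftInverse_invFun hj1 _]
    exact hu b b'
  · intro g' hg' k1 k2 e n hn
    refine h1 (fun e => g' e n) ?_ e
    obtain ⟨b, rfl⟩ := (hker n).1 hn
    intro x y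
    have c1 := hg' x y (j b)
    have c2 := hg' x (j b) y
    have c3 := k2 (j b) x y (pj b)
    have c4 := k1 (j b) y (pj b)
    simp only [pj, f2, f3, (hj b x).eq, (hj b y).eq] at *
    grind

/-- The universal central extension class. -/
lemma central_u2 {B : Type} [AddCommGroup B] {π : E →* Q}
    (j : Multiplicative B →* E) (hj : ∀ b e, Commute (j b) e)
    (hker : ∀ e, π e = 1 ↔ ∃ b, j b = e) (hj1 : Function.Injective j) (h1 : A1 E) (h2 : A2 E)
    (s : Q → E) (hs : ∀ x, π (s x) = x) (κ : Q → Q → B)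
    (hκ : ∀ x y, s x * s y = j (Multiplicative.ofAdd (κ x y)) * s (x * y)) : U2 Q B κ := by
  have pj : ∀ b, π (j b) = 1 := fun b => (hker _).2 ⟨b, rfl⟩
  refine ⟨?_, ?_, ?_⟩
  · intro x y z
    have e1 : s x * s y * s z = j (Multiplicative.ofAdd (κ x y + κ (x * y) z)) * s (x * y * z) := by
      rw [hκ, mul_assoc, hκ, ofAdd_add, map_mul]
      simp only [mul_assoc]
    have e2 : s x * s y * s z = j (Multiplicative.ofAdd (κ y z + κ x (y * z))) * s (x * y * z) := by
      rw [mul_assoc, hκ y z, ← mul_assoc, ← (hj _ (s x)).eq, mul_assoc, hκ, ofAdd_add, map_mul,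
        mul_assoc, mul_assoc x]
    rw [e1] at e2
    have := hj1 (mul_right_cancel e2)
    have := Multiplicative.ofAdd.injective this
    grind
  · intro f hf
    obtain ⟨u, hu⟩ := h2 _ (hf.comp π)
    simp only at hu
    have c1 : ∀ b e, u (j b * e) = u (j b) + u e - f 1 1 := by
      intro b e
      have := hu (j b) e
      rw [pj, hf.one_left] at this
      grind
    let c : B →+ TT := AddMonoidHom.mk' (fun b => u (j (Multiplicative.ofAdd b)) - f 1 1) (by
      intro a b
      rw [ofAdd_add, map_mul, c1]
      abel)
    refine ⟨-c, fun x => u (s x), fun x y => ?_⟩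
    have e := hu (s x) (s y)
    rw [hs, hs, hκ, c1] at e
    simp only [AddMonoidHom.neg_apply, c, AddMonoidHom.mk'_apply]
    grind
  · rintro c ⟨v, hv⟩
    have hb : ∀ e, ∃ b : B, e = j (Multiplicative.ofAdd b) * s (π e) := by
      intro e
      obtain ⟨b, hb⟩ := (hker (e * (s (π e))⁻¹)).1 (by simp [hs])
      exact ⟨Multiplicative.toAdd b, by simp [hb]⟩
    choose β hβ using hb
    have uniq : ∀ e b, e = j (Multiplicative.ofAdd b) * s (π e) → β e = b := by
      intro e b h
      have := hβ e
      nth_rewrite 1 [h] at this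
      exact Multiplicative.ofAdd.injective (hj1 (mul_right_cancel this).symm)
    have hom : Coc1 (fun e => c (β e) + v (π e)) := by
      intro x y
      have : β (x * y) = β x + β y + κ (π x) (π y) := by
        apply uniq
        conv_lhs => rw [hβ x, hβ y]
        rw [mul_assoc, ← mul_assoc (s (π x)), ← (hj _ (s (π x))).eq, mul_assoc _ (s (π x)), hκ,
          ofAdd_add, ofAdd_add, map_mul, map_mul, map_mul]
        simp only [mul_assoc]
      have e := hv (π x) (π y)
      simp only [this, map_add, map_mul] at *
      rw [e]
      abel
    ext b
    have e1 := h1 _ hom (j (Multiplicative.ofAdd b))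
    have e2 := h1 _ hom 1
    have e3 : β (j (Multiplicative.ofAdd b)) = b + β 1 := by
      apply uniq
      rw [pj, ofAdd_add, map_mul, mul_assoc]
      have := hβ 1
      rw [map_one] at this
      rw [← this, mul_one]
    simp only [e3, pj, map_one, map_add] at *
    simp only [AddMonoidHom.zero_apply]
    grind

lemma A1.quot {π : E →* Q} (hπ : Function.Surjective π) (h : A1 E) : A1 Q := by
  intro f hf x
  obtain ⟨e, rfl⟩ := hπ x
  exact h _ (hf.comp π) e

lemma A2.quot {π : E →* Q} (hπ : Function.Surjective π) (hN : A1 π.ker) (h2 : A2 E) : A2 Q := by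
  intro f hf
  obtain ⟨u, hu⟩ := h2 _ (hf.comp π)
  simp only at hu
  obtain ⟨s, hs⟩ := hπ.hasRightInverse
  have c1 : ∀ n e, π n = 1 → u (n * e) = u n + u e - f 1 1 := by
    intro n e hn
    have := hu n e
    rw [hn, hf.one_left] at this
    grind
  have c2 : ∀ n, π n = 1 → u n = f 1 1 := by
    intro n hn
    have := hN (fun n => u n - f 1 1) (by
      rintro ⟨n, hn⟩ ⟨n', hn'⟩
      have := c1 n n' hn
      simp only [Subgroup.coe_mul, this]
      abel) ⟨n, hn⟩
    exact sub_eq_zero.mp this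
  refine ⟨fun x => u (s x), fun x y => ?_⟩
  have e := hu (s x) (s y)
  have e2 : u (s x * s y) = u (s (x * y)) := by
    have := c1 (s x * s y * (s (x * y))⁻¹) (s (x * y)) (by simp [hs _])
    rw [inv_mul_cancel_right, c2 (s x * s y * (s (x * y))⁻¹) (by simp [hs _])] at this
    rw [this]; abel
  rw [hs, hs, e2] at e
  exact e

end Quot
end Rz


open CategoryTheory AlgebraicTopology

namespace Rz

section Bridge

lemma sc_homology_aux {R : Type} [CommRing R] (S : ShortComplex (ModuleCat.{0} R)) (C : Type)
    [AddCommGroup C] [Module R C]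
    (kk2 : S.X₂ →ₗ[R] C) (hk : ∀ x : S.X₁, kk2 (S.f x) = 0)
    (h1 : ∀ φ : S.X₂ →+ TT, (∀ x : S.X₁, φ (S.f x) = 0) →
      ∃ (c : C →+ TT) (u : S.X₃ →+ TT), ∀ x, φ x = c (kk2 x) + u (S.g x))
    (h2 : ∀ (c : C →+ TT) (u : S.X₃ →+ TT), (∀ x, c (kk2 x) = u (S.g x)) → c = 0) :
    Nonempty (S.homology ≃+ C) := by
  let k : S.X₂ →+ C := kk2.toAddMonoidHom
  let kk : LinearMap.ker S.g.hom →ₗ[R] C := kk2.comp (LinearMap.ker S.g.hom).subtype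
  have hkk : ∀ x, kk x = k x.1 := fun x => rfl
  have hker : LinearMap.ker kk = LinearMap.range S.moduleCatToCycles := by
    ext x
    constructor
    · intro hx
      have hx : kk2 x.1 = 0 := hx
      by_contra hn
      have hn2 : (QuotientAddGroup.mk' S.f.hom.toAddMonoidHom.range) x.1 ≠ 0 := by
        intro h
        rw [QuotientAddGroup.mk'_apply, QuotientAddGroup.eq_zero_iff] at h
        obtain ⟨y, hy⟩ := h
        exact hn ⟨y, Subtype.ext hy⟩
      obtain ⟨c, hc⟩ := exists_char hn2
      obtain ⟨c', u, h⟩ := h1 (c.comp (QuotientAddGroup.mk' S.f.hom.toAddMonoidHom.range)) (by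
        intro y
        have : (QuotientAddGroup.mk' S.f.hom.toAddMonoidHom.range) (S.f y) = 0 := by
          rw [QuotientAddGroup.mk'_apply, QuotientAddGroup.eq_zero_iff]
          exact ⟨y, rfl⟩
        rw [AddMonoidHom.comp_apply, this, map_zero])
      apply hc
      have e := h x.1
      have e2 : S.g x.1 = 0 := x.2
      rw [hx, e2, map_zero, map_zero, add_zero] at e
      exact e
    · rintro ⟨y, rfl⟩
      exact hk y
  have hsurj : Function.Surjective kk := by
    intro y
    by_contra hn
    have hn2 : (QuotientAddGroup.mk' kk.toAddMonoidHom.range) y ≠ 0 := by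
      intro h
      rw [QuotientAddGroup.mk'_apply, QuotientAddGroup.eq_zero_iff] at h
      exact hn h
    obtain ⟨c, hc⟩ := exists_char hn2
    let c' := c.comp (QuotientAddGroup.mk' kk.toAddMonoidHom.range)
    obtain ⟨u, hu⟩ := char_factor S.g.hom.toAddMonoidHom (c'.comp k) (by
      intro x hx
      have : (QuotientAddGroup.mk' kk.toAddMonoidHom.range) (k x) = 0 := by
        rw [QuotientAddGroup.mk'_apply, QuotientAddGroup.eq_zero_iff]
        exact ⟨⟨x, hx⟩, rfl⟩
      simp only [c', AddMonoidHom.comp_apply, this, map_zero])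
    have := h2 c' u hu
    exact hc (DFunLike.congr_fun this y)
  let e1 : S.homology ≃ₗ[R] _ := S.moduleCatHomologyIso.toLinearEquiv
  let e2 := (Submodule.quotEquivOfEq _ _ hker.symm).trans (kk.quotKerEquivOfSurjective hsurj)
  exact ⟨(e1.trans e2).toAddEquiv⟩

lemma sc_homology (S : ShortComplex (ModuleCat.{0} ℤ)) (C : Type) [AddCommGroup C]
    (k : S.X₂ →+ C) (hk : ∀ x : S.X₁, k (S.f x) = 0)
    (h1 : ∀ φ : S.X₂ →+ TT, (∀ x : S.X₁, φ (S.f x) = 0) →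
      ∃ (c : C →+ TT) (u : S.X₃ →+ TT), ∀ x, φ x = c (k x) + u (S.g x))
    (h2 : ∀ (c : C →+ TT) (u : S.X₃ →+ TT), (∀ x, c (k x) = u (S.g x)) → c = 0) :
    Nonempty (S.homology ≃+ C) := by
  exact sc_homology_aux S C
    { toFun := k
      map_add' := fun x y => map_add k x y
      map_smul' := fun m x => by simpa using map_intCast_smul k ℤ ℤ m x } hk h1 h2

variable {G : Type} [Group G] {n : ℕ}

noncomputable def bas (F : ComposableArrows (SingleObj G) n) : (classifyingComplex G).X n :=
  ModuleCat.freeMk F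

def face (i : Fin (n + 2)) (F : ComposableArrows (SingleObj G) (n + 1)) :
    ComposableArrows (SingleObj G) n := (nerve (SingleObj G)).δ i F

lemma objD_apply (X : SimplicialObject (ModuleCat.{0} ℤ)) (n : ℕ)
    (v : X.obj (Opposite.op (SimplexCategory.mk (n + 1)))) :
    AlternatingFaceMapComplex.objD X n v = ∑ i : Fin (n + 2), (-1 : ℤ) ^ (i : ℕ) • X.δ i v := by
  have h : ∀ (s : Finset (Fin (n + 2))), (∑ i ∈ s, (-1 : ℤ) ^ (i : ℕ) • X.δ i :
      X.obj (Opposite.op (SimplexCategory.mk (n + 1))) ⟶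
        X.obj (Opposite.op (SimplexCategory.mk n))) v
      = ∑ i ∈ s, (-1 : ℤ) ^ (i : ℕ) • X.δ i v := by
    intro s
    refine (DFunLike.congr_fun (ModuleCat.hom_sum _ s) v).trans ?_
    rw [LinearMap.sum_apply]
    rfl
  exact h _

lemma d_bas (F : ComposableArrows (SingleObj G) (n + 1)) :
    (classifyingComplex G).d (n + 1) n (bas F) = ∑ i : Fin (n + 2), (-1 : ℤ) ^ (i : ℕ) • bas (face i F) := by
  have h : (classifyingComplex G).d (n + 1) n = AlternatingFaceMapComplex.objD (((SimplicialObject.whiskering (Type) (ModuleCat ℤ)).obj (ModuleCat.free ℤ)).obj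
      (nerve (SingleObj G))) n :=
    alternatingFaceMapComplex_obj_d _ n
  rw [h]
  refine (objD_apply _ n _).trans (Finset.sum_congr rfl fun i _ => ?_)
  congr 1
  exact ModuleCat.free_map_apply _ _

lemma bas_lift {M : Type} [AddCommGroup M] (f : ComposableArrows (SingleObj G) n → M) :
    ∃ φ : (classifyingComplex G).X n →+ M, ∀ F, φ (bas F) = f F :=
  ⟨LL f, fun F => by erw [LL_single]; simp⟩

lemma bas_ext {M : Type} [AddCommGroup M] {φ ψ : (classifyingComplex G).X n →+ M}
    (h : ∀ F, φ (bas F) = ψ (bas F)) : φ = ψ :=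
  Finsupp.addHom_ext' (N := M) (f := φ) (g := ψ) fun F => AddMonoidHom.ext_int (h F)

def ed (F : ComposableArrows (SingleObj G) n) (i j : Fin (n + 1)) (h : i ≤ j) : G :=
  F.map (homOfLE h)

lemma ed_self (F : ComposableArrows (SingleObj G) n) (i : Fin (n + 1)) (h : i ≤ i) :
    ed F i i h = 1 := F.map_id i

lemma ed_comp (F : ComposableArrows (SingleObj G) n) (i j k : Fin (n + 1)) (h : i ≤ j)
    (h' : j ≤ k) : ed F i k (h.trans h') = ed F j k h' * ed F i j h :=
  F.map_comp (homOfLE h) (homOfLE h')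

lemma ed_face (F : ComposableArrows (SingleObj G) (n + 1)) (a : Fin (n + 2)) (i j : Fin (n + 1))
    (h : i ≤ j) : ed (face a F) i j h =
      ed F (a.succAbove i) (a.succAbove j) ((Fin.succAboveOrderEmb a).monotone h) := rfl

def Fv (v : Fin (n + 1) → G) : ComposableArrows (SingleObj G) n where
  obj _ := SingleObj.star G
  map {i j} _ := (v j * (v i)⁻¹ : G)
  map_id i := mul_inv_cancel (v i)
  map_comp {i j k} _ _ := by
    change (v k * (v i)⁻¹ : G) = (v k * (v j)⁻¹) * (v j * (v i)⁻¹)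
    group

lemma ed_Fv (v : Fin (n + 1) → G) (i j : Fin (n + 1)) (h : i ≤ j) :
    ed (Fv v) i j h = v j * (v i)⁻¹ := rfl

lemma eq_Fv (F : ComposableArrows (SingleObj G) n) : F = Fv (fun i => ed F 0 i (Fin.zero_le i)) := by
  refine CategoryTheory.Functor.hext (fun _ => rfl) fun i j f => heq_of_eq ?_
  have := ed_comp F 0 i j (Fin.zero_le i) (leOfHom f)
  change ed F i j (leOfHom f) = ed F 0 j (Fin.zero_le j) * (ed F 0 i (Fin.zero_le i))⁻¹
  rw [this]; group

def mk1 (x : G) : ComposableArrows (SingleObj G) 1 := Fv ![1, x]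
def mk2 (x y : G) : ComposableArrows (SingleObj G) 2 := Fv ![1, y, x * y]
def mk3 (x y z : G) : ComposableArrows (SingleObj G) 3 := Fv ![1, z, y * z, x * y * z]
def mk4 (x y z w : G) : ComposableArrows (SingleObj G) 4 :=
  Fv ![1, w, z * w, y * z * w, x * y * z * w]

lemma eq_mk1 (F : ComposableArrows (SingleObj G) 1) : F = mk1 (ed F 0 1 (by decide)) := by
  conv_lhs => rw [eq_Fv F]
  unfold mk1
  congr 1
  funext i
  fin_cases i
  · exact ed_self F 0 _
  · rfl

lemma eq_mk2 (F : ComposableArrows (SingleObj G) 2) :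
    F = mk2 (ed F 1 2 (by decide)) (ed F 0 1 (by decide)) := by
  conv_lhs => rw [eq_Fv F]
  unfold mk2
  congr 1
  funext i
  fin_cases i
  · exact ed_self F 0 _
  · rfl
  · exact ed_comp F 0 1 2 (by decide) (by decide)

lemma eq_mk3 (F : ComposableArrows (SingleObj G) 3) :
    F = mk3 (ed F 2 3 (by decide)) (ed F 1 2 (by decide)) (ed F 0 1 (by decide)) := by
  conv_lhs => rw [eq_Fv F]
  unfold mk3
  congr 1
  funext i
  fin_cases i
  · exact ed_self F 0 _
  · rfl
  · exact ed_comp F 0 1 2 (by decide) (by decide)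
  · refine (ed_comp F 0 2 3 (by decide) (by decide)).trans ?_
    rw [ed_comp F 0 1 2 (by decide) (by decide), ← mul_assoc]; rfl

lemma eq_mk4 (F : ComposableArrows (SingleObj G) 4) :
    F = mk4 (ed F 3 4 (by decide)) (ed F 2 3 (by decide)) (ed F 1 2 (by decide))
      (ed F 0 1 (by decide)) := by
  conv_lhs => rw [eq_Fv F]
  unfold mk4
  congr 1
  funext i
  fin_cases i
  · exact ed_self F 0 _
  · rfl
  · exact ed_comp F 0 1 2 (by decide) (by decide)
  · refine (ed_comp F 0 2 3 (by decide) (by decide)).trans ?_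
    rw [ed_comp F 0 1 2 (by decide) (by decide), ← mul_assoc]; rfl
  · refine (ed_comp F 0 3 4 (by decide) (by decide)).trans ?_
    rw [ed_comp F 0 2 3 (by decide) (by decide), ed_comp F 0 1 2 (by decide) (by decide),
      ← mul_assoc, ← mul_assoc]; rfl

lemma d2 (x y : G) : (classifyingComplex G).d 2 1 (bas (mk2 x y)) =
    bas (mk1 x) - bas (mk1 (x * y)) + bas (mk1 y) := by
  rw [d_bas, Fin.sum_univ_three, eq_mk1 (face 0 _), eq_mk1 (face 1 _), eq_mk1 (face 2 _)]
  simp only [ed_face]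
  simp [mk2, ed_Fv, Fin.succAbove, sub_eq_add_neg]

lemma d3 (x y z : G) : (classifyingComplex G).d 3 2 (bas (mk3 x y z)) =
    bas (mk2 x y) - bas (mk2 x (y * z)) + bas (mk2 (x * y) z) - bas (mk2 y z) := by
  rw [d_bas, Fin.sum_univ_four, eq_mk2 (face 0 _), eq_mk2 (face 1 _), eq_mk2 (face 2 _),
    eq_mk2 (face 3 _)]
  simp only [ed_face]
  simp [mk3, ed_Fv, Fin.succAbove, sub_eq_add_neg]

lemma d4 (x y z w : G) : (classifyingComplex G).d 4 3 (bas (mk4 x y z w)) =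
    bas (mk3 x y z) - bas (mk3 x y (z * w)) + bas (mk3 x (y * z) w) - bas (mk3 (x * y) z w)
      + bas (mk3 y z w) := by
  rw [d_bas, Fin.sum_univ_five, eq_mk3 (face 0 _), eq_mk3 (face 1 _), eq_mk3 (face 2 _),
    eq_mk3 (face 3 _), eq_mk3 (face 4 _)]
  simp only [ed_face]
  simp [mk4, ed_Fv, Fin.succAbove, sub_eq_add_neg]

lemma cc_homology (S C : Type) [Group S] [AddCommGroup C] (n : ℕ)
    (k : (classifyingComplex S).X (n + 1) →+ C)
    (hk : ∀ F, k ((classifyingComplex S).d (n + 2) (n + 1) (bas F)) = 0)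
    (h1 : ∀ φ : (classifyingComplex S).X (n + 1) →+ TT,
      (∀ F, φ ((classifyingComplex S).d (n + 2) (n + 1) (bas F)) = 0) →
      ∃ (c : C →+ TT) (u : (classifyingComplex S).X n →+ TT),
        ∀ F, φ (bas F) = c (k (bas F)) + u ((classifyingComplex S).d (n + 1) n (bas F)))
    (h2 : ∀ (c : C →+ TT) (u : (classifyingComplex S).X n →+ TT),
      (∀ F, c (k (bas F)) = u ((classifyingComplex S).d (n + 1) n (bas F))) → c = 0) :
    Nonempty (grpHomology S (n + 1) ≃+ C) := by
  have e := ((classifyingComplex S).homologyIsoSc' (n + 2) (n + 1) n (by simp) (by simp)).toLinearEquiv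
  have : Nonempty (((classifyingComplex S).sc' (n + 2) (n + 1) n).homology ≃+ C) := by
    refine sc_homology _ _ k ?_ (fun φ hφ => ?_) (fun c u hc => ?_)
    · have : k.comp ((classifyingComplex S).d (n + 2) (n + 1)).hom.toAddMonoidHom = 0 :=
        bas_ext fun F => hk F
      exact fun x => DFunLike.congr_fun this x
    · obtain ⟨c, u, h⟩ := h1 φ (fun F => hφ _)
      refine ⟨c, u, ?_⟩
      have : φ = c.comp k + u.comp ((classifyingComplex S).d (n + 1) n).hom.toAddMonoidHom :=
        bas_ext fun F => h F
      exact fun x => DFunLike.congr_fun this x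
    · exact h2 c u fun F => hc _
  obtain ⟨e2⟩ := this
  exact ⟨e.toAddEquiv.trans e2⟩

theorem A1.grp {S : Type} [Group S] (h : A1 S) : Subsingleton (grpHomology S 1) := by
  have : Nonempty (grpHomology S 1 ≃+ PUnit.{1}) := by
    refine cc_homology S PUnit.{1} 0 0 (fun _ => rfl) (fun φ hφ => ⟨0, 0, fun F => ?_⟩)
      (fun c u _ => ?_)
    · rw [eq_mk1 F]
      refine (h (fun x => φ (bas (mk1 x))) (fun x y => ?_) _).trans (by simp)
      have h2 := hφ (mk2 x y)
      erw [d2] at h2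
      rw [map_add, map_sub] at h2
      grind
    · ext x
      exact map_zero c
  obtain ⟨e2⟩ := this
  exact e2.toEquiv.subsingleton

theorem U2.grp {S C : Type} [Group S] [AddCommGroup C] {κ : S → S → C} (h : U2 S C κ) :
    Nonempty (grpHomology S 2 ≃+ C) := by
  obtain ⟨k, hk⟩ := bas_lift (G := S) (n := 2)
    (fun F => κ (ed F 1 2 (by decide)) (ed F 0 1 (by decide)))
  have hk2 : ∀ x y, k (bas (mk2 x y)) = κ x y := fun x y => by
    rw [hk]; simp [mk2, ed_Fv]
  refine cc_homology S C 1 k (fun F => ?_) (fun φ hφ => ?_) (fun c u hc => ?_)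
  · rw [eq_mk3 F]
    erw [d3]
    simp only [map_add, map_sub, hk2]
    have := h.1 (ed F 2 3 (by decide)) (ed F 1 2 (by decide)) (ed F 0 1 (by decide))
    grind
  · obtain ⟨c, v, hv⟩ := h.2.1 (fun x y => φ (bas (mk2 x y))) (by
      intro x y z
      have h2 := hφ (mk3 x y z)
      erw [d3] at h2
      simp only [map_add, map_sub] at h2
      grind)
    obtain ⟨u, hu⟩ := bas_lift (G := S) (n := 1) (fun F => v (ed F 0 1 (by decide)))
    have hu2 : ∀ x, u (bas (mk1 x)) = v x := fun x => by
      rw [hu]; simp [mk1, ed_Fv]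
    refine ⟨c, u, fun F => ?_⟩
    rw [eq_mk2 F]
    erw [d2]
    simp only [map_add, map_sub, hk2, hu2]
    have := hv (ed F 1 2 (by decide)) (ed F 0 1 (by decide))
    grind
  · refine h.2.2 c ⟨fun x => u (bas (mk1 x)), fun x y => ?_⟩
    have h3 := hc (mk2 x y)
    erw [d2] at h3
    simp only [map_add, map_sub, hk2] at h3
    grind

theorem U3.grp {S C : Type} [Group S] [AddCommGroup C] {κ : S → S → S → C} (h : U3 S C κ) :
    Nonempty (grpHomology S 3 ≃+ C) := by
  obtain ⟨k, hk⟩ := bas_lift (G := S) (n := 3)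
    (fun F => κ (ed F 2 3 (by decide)) (ed F 1 2 (by decide)) (ed F 0 1 (by decide)))
  have hk2 : ∀ x y z, k (bas (mk3 x y z)) = κ x y z := fun x y z => by
    rw [hk]; simp [mk3, ed_Fv]
  refine cc_homology S C 2 k (fun F => ?_) (fun φ hφ => ?_) (fun c u hc => ?_)
  · rw [eq_mk4 F]
    erw [d4]
    simp only [map_add, map_sub, hk2]
    have := h.1 (ed F 3 4 (by decide)) (ed F 2 3 (by decide)) (ed F 1 2 (by decide))
      (ed F 0 1 (by decide))
    grind
  · obtain ⟨c, v, hv⟩ := h.2.1 (fun x y z => φ (bas (mk3 x y z))) (by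
      intro x y z w
      have h2 := hφ (mk4 x y z w)
      erw [d4] at h2
      simp only [map_add, map_sub] at h2
      grind)
    obtain ⟨u, hu⟩ := bas_lift (G := S) (n := 2)
      (fun F => - v (ed F 1 2 (by decide)) (ed F 0 1 (by decide)))
    have hu2 : ∀ x y, u (bas (mk2 x y)) = - v x y := fun x y => by
      rw [hu]; simp [mk2, ed_Fv]
    refine ⟨c, u, fun F => ?_⟩
    rw [eq_mk3 F]
    erw [d3]
    simp only [map_add, map_sub, hk2, hu2]
    have := hv (ed F 2 3 (by decide)) (ed F 1 2 (by decide)) (ed F 0 1 (by decide))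
    grind
  · refine h.2.2 c ⟨fun x y => - u (bas (mk2 x y)), fun x y z => ?_⟩
    have h3 := hc (mk3 x y z)
    erw [d3] at h3
    simp only [map_add, map_sub, hk2] at h3
    grind

end Bridge
end Rz


open CategoryTheory AlgebraicTopology

namespace Rz

lemma disp_comm {G : Type} [Group G] (K : Subgroup G) [K.Normal] {k x x' : G} (hk : k ∈ K)
    (h : Commute (k * x * k⁻¹) x') : x * x' * x⁻¹ * x'⁻¹ ∈ K := by
  rw [← QuotientGroup.eq_one_iff]
  have e : ((k : G) : G ⧸ K) = 1 := (QuotientGroup.eq_one_iff _).2 hk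
  have h2 : (((k * x * k⁻¹ * x' : G)) : G ⧸ K) = ((x' * (k * x * k⁻¹) : G) : G ⧸ K) := by
    rw [h.eq]
  simp only [QuotientGroup.mk_mul, QuotientGroup.mk_inv, e, one_mul, inv_one, mul_one] at h2 ⊢
  rw [h2]; group

lemma perm_disp {X : Type} (U : Set X) (k x x' : Equiv.Perm X) (hk : ∀ u ∈ U, k u ∉ U)
    (hx : ∀ v, v ∉ U → x v = v) (hx' : ∀ v, v ∉ U → x' v = v) :
    Commute (k * x * k⁻¹) x' := by
  apply Equiv.Perm.Disjoint.commute
  intro v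
  by_cases hv : v ∈ U
  · left
    have : k⁻¹ v ∉ U := fun h => hk _ h (by simpa using hv)
    change k (x (k⁻¹ v)) = v
    rw [hx _ this]; simp
  · right
    exact hx' v hv

section T
variable {G Z : Type} [Group G] [CommGroup Z]

def sl : (Bool → Equiv.Perm (G × G)) →* Equiv.Perm (Bool × G × G) where
  toFun s := ⟨fun v => (v.1, s v.1 v.2), fun v => (v.1, (s v.1)⁻¹ v.2),
    fun v => by simp, fun v => by simp⟩
  map_one' := by ext v <;> rfl
  map_mul' s s' := by ext v <;> rfl

lemma sl_apply (s : Bool → Equiv.Perm (G × G)) (v) : sl s v = (v.1, s v.1 v.2) := rfl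

def Lm : G →* Equiv.Perm (G × G) where
  toFun h := ⟨fun v => (h * v.1, v.2), fun v => (h⁻¹ * v.1, v.2), fun v => by simp,
    fun v => by simp⟩
  map_one' := by ext v <;> simp
  map_mul' s s' := by ext v <;> simp [mul_assoc]

def Fm : G →* Equiv.Perm (G × G) where
  toFun h := ⟨fun v => (v.1, h * v.2), fun v => (v.1, h⁻¹ * v.2), fun v => by simp,
    fun v => by simp⟩
  map_one' := by ext v <;> simp
  map_mul' s s' := by ext v <;> simp [mul_assoc]

def tm : Equiv.Perm (G × G) :=
  ⟨fun v => (v.2 * v.1, v.2), fun v => (v.2⁻¹ * v.1, v.2), fun v => by simp, fun v => by simp⟩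

lemma tm_conj (h : G) : tm * Fm h * tm⁻¹ = Lm h * Fm h := by
  rw [mul_inv_eq_iff_eq_mul]
  ext v <;> simp [tm, Fm, Lm, mul_assoc]

def lam : G →* Equiv.Perm (Bool × G × G) where
  toFun h := sl (fun _ => Lm h)
  map_one' := by rw [map_one]; exact map_one sl
  map_mul' h h' := by
    rw [← map_mul sl]
    congr 1
    funext b
    exact map_mul Lm h h'

lemma lam_apply (h : G) (v) : lam h v = (v.1, h * v.2.1, v.2.2) := rfl

lemma lam_inj : Function.Injective (lam : G →* _) := by
  intro h h' e
  have := congrArg (fun p => (p (true, 1, 1)).2.1) e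
  simpa [lam_apply] using this

def T (j : Z →* G) : Subgroup (Equiv.Perm (Bool × G × G)) :=
  Subgroup.centralizer (Set.range fun z => lam (j z))

lemma mem_T {j : Z →* G} {p : Equiv.Perm (Bool × G × G)} :
    p ∈ T j ↔ ∀ z v, p (lam (j z) v) = lam (j z) (p v) := by
  rw [T, Subgroup.mem_centralizer_iff]
  constructor
  · intro h z v
    exact (Equiv.congr_fun (h _ ⟨z, rfl⟩) v).symm
  · rintro h _ ⟨z, rfl⟩
    ext1 v
    exact (h z v).symm

lemma sl_mem {j : Z →* G} (s : Bool → Equiv.Perm (G × G))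
    (h : ∀ b z v, s b (Lm (j z) v) = Lm (j z) (s b v)) : sl s ∈ T j := by
  rw [mem_T]
  intro z v
  change (v.1, s v.1 (Lm (j z) v.2)) = (v.1, Lm (j z) (s v.1 v.2))
  rw [h]

variable {j : Z →* G} (hj : ∀ z g, Commute (j z) g)

lemma lam_mem (hj : ∀ z g, Commute (j z) g)
    (h : G) : lam h ∈ T j :=
  sl_mem (fun _ => Lm h) fun b z v => by simp [Lm, ← mul_assoc, (hj z h).eq]

def lamT (hj : ∀ z g, Commute (j z) g) : G →* T j := lam.codRestrict _ (lam_mem hj)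

lemma lamT_inj : Function.Injective (lamT hj) := fun h h' e =>
  lam_inj (congrArg Subtype.val e)

lemma lamT_cent (z : Z) (p : T j) : Commute (lamT hj (j z)) p :=
  Subtype.ext (Equiv.ext fun v => (mem_T.1 p.2 z v).symm)

lemma Fm_eq (h : G) (z : Z) (v) : Fm h (Lm (j z) v) = Lm (j z) (Fm h v) := rfl

lemma tm_eq (hj : ∀ z g, Commute (j z) g)
    (z : Z) (v) : tm (Lm (j z) v) = Lm (j z) (tm v) := by
  simp [tm, Lm, ← mul_assoc, (hj z v.2).eq]

lemma lamT_mit : Mit (lamT hj) := by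
  have hF : ∀ h : G, sl (fun _ => Fm h) ∈ T j := fun h => sl_mem _ fun b z v => rfl
  refine ⟨⟨⟨fun h => ⟨sl (fun _ => Fm h), hF h⟩, ?_⟩, ?_⟩, ⟨sl fun _ => tm, sl_mem _ fun b z v => tm_eq hj z v⟩,
    fun h h' => ?_, fun h => ?_⟩
  · apply Subtype.ext
    change sl _ = 1
    rw [map_one]; exact map_one sl
  · intro h h'
    apply Subtype.ext
    change sl _ = sl _ * sl _
    rw [← map_mul sl]
    congr 1
    funext b
    exact map_mul Fm h h'
  · apply Subtype.ext
    rfl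
  · apply Subtype.ext
    change sl (fun _ => tm) * sl (fun _ => Fm h) * (sl (fun _ => tm))⁻¹ = sl (fun _ => Lm h) * sl (fun _ => Fm h)
    rw [← map_inv, ← map_mul, ← map_mul, ← map_mul]
    congr 1
    funext b
    exact tm_conj h

lemma mem_T' {p : Equiv.Perm (Bool × G × G)} :
    p ∈ T j ↔ ∀ z b x y, p (b, j z * x, y) = lam (j z) (p (b, x, y)) :=
  mem_T.trans ⟨fun h z b x y => h z (b, x, y), fun h z v => h z v.1 v.2.1 v.2.2⟩

/-- The centre of `T j` comes from the centre of `G`. -/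
lemma T_center [Nontrivial G] (c : T j) (hc : ∀ p, Commute c p) :
    ∃ c0 : G, (∀ g, Commute c0 g) ∧ lamT hj c0 = c := by
  classical
  obtain ⟨c, hcT⟩ := c
  have hc' : ∀ p ∈ T j, ∀ v, c (p v) = p (c v) := fun p hp v =>
    Equiv.congr_fun (congrArg Subtype.val (hc ⟨p, hp⟩).eq) v
  let Rt : G → Equiv.Perm (Bool × G × G) := fun g =>
    ⟨fun v => (v.1, v.2.1 * g, v.2.2), fun v => (v.1, v.2.1 * g⁻¹, v.2.2),
      fun v => by simp, fun v => by simp⟩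
  have hRt : ∀ g, Rt g ∈ T j := fun g => mem_T'.2 fun z b x y => by
    simp [Rt, lam_apply, mul_assoc]
  let Pt : Equiv.Perm (Bool × G) → Equiv.Perm (Bool × G × G) := fun q =>
    ⟨fun v => ((q (v.1, v.2.2)).1, v.2.1, (q (v.1, v.2.2)).2),
     fun v => ((q⁻¹ (v.1, v.2.2)).1, v.2.1, (q⁻¹ (v.1, v.2.2)).2),
      fun v => by simp, fun v => by simp⟩
  have hPt : ∀ q, Pt q ∈ T j := fun q => mem_T'.2 fun z b x y => by
    simp [Pt, lam_apply]
  have hPa : ∀ q b x y, Pt q (b, x, y) = ((q (b, y)).1, x, (q (b, y)).2) := fun _ _ _ _ => rfl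
  have key : ∀ b y, ((c (b, 1, y)).1, (c (b, 1, y)).2.2) = (b, y) := by
    intro b y
    by_contra hne
    obtain ⟨w, hw1, hw2⟩ : ∃ w : Bool × G, w ≠ (b, y) ∧
        w ≠ ((c (b, 1, y)).1, (c (b, 1, y)).2.2) := by
      obtain ⟨y', hy'⟩ := exists_ne y
      by_cases h : ((!b, y) : Bool × G) = ((c (b, 1, y)).1, (c (b, 1, y)).2.2)
      · refine ⟨(b, y'), fun e => hy' (congrArg Prod.snd e), fun e => ?_⟩
        rw [← h] at e
        exact hy' (congrArg Prod.snd e)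
      · exact ⟨(!b, y), fun e => by simpa using congrArg Prod.fst e, h⟩
    have h1 := hc' _ (hPt (Equiv.swap ((c (b, 1, y)).1, (c (b, 1, y)).2.2) w)) (b, 1, y)
    rw [hPa, Equiv.swap_apply_of_ne_of_ne (Ne.symm hne) hw1.symm] at h1
    have h2 := congrArg (fun v : Bool × G × G => (v.1, v.2.2)) h1
    simp only [Pt, Equiv.coe_fn_mk, Equiv.swap_apply_left] at h2
    exact hw2 h2.symm
  have key2 : ∀ b y, c (b, 1, y) = (b, (c (true, 1, 1)).2.1, y) := by
    intro b y
    have h1 := hc' _ (hPt (Equiv.swap (true, 1) (b, y))) (true, 1, 1)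
    rw [hPa, Equiv.swap_apply_left] at h1
    have h2 := congrArg (fun v : Bool × G × G => v.2.1) h1
    have h3 := key b y
    change (c (b, 1, y)).2.1 = (c (true, 1, 1)).2.1 at h2
    rw [Prod.mk.injEq] at h3
    rw [← h2]
    ext <;> simp [h3]
  have key3 : ∀ b x y, c (b, x, y) = (b, (c (true, 1, 1)).2.1 * x, y) := by
    intro b x y
    have h1 := hc' _ (hRt x) (b, 1, y)
    rw [key2] at h1
    simpa [Rt] using h1
  refine ⟨(c (true, 1, 1)).2.1, fun g => ?_, ?_⟩
  · have h1 := hc' _ (lam_mem hj g) (true, 1, 1)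
    rw [lam_apply, key3, key2, lam_apply] at h1
    have := congrArg (fun v : Bool × G × G => v.2.1) h1
    have h3 : (c (true, 1, 1)).2.1 * g = g * (c (true, 1, 1)).2.1 := by simpa using this
    exact h3
  · apply Subtype.ext
    ext1 ⟨b, x, y⟩
    exact (key3 b x y).symm

lemma triv_eq (hj : ∀ z g, Commute (j z) g)
    (hi : Function.Injective j) : ∃ (R : Type) (e : G ≃ Z × R),
    (∀ z g, e (j z * g) = (z * (e g).1, (e g).2)) := by
  let ψ : Z × (G ⧸ j.range) → G := fun p => j p.1 * p.2.out
  have h0 : ∀ p, ((ψ p : G) : G ⧸ j.range) = p.2 := by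
    intro p
    have : ((ψ p : G) : G ⧸ j.range) = ((p.2.out : G) : G ⧸ j.range) := by
      rw [QuotientGroup.eq]
      refine ⟨p.1⁻¹, ?_⟩
      simp only [ψ, mul_inv_rev]
      rw [mul_assoc, ← map_inv, (hj _ _).eq]; group
    rw [this]
    exact Quotient.out_eq _
  have hψ : Function.Bijective ψ := by
    constructor
    · rintro p q h
      have h1 : p.2 = q.2 := by rw [← h0 p, h, h0]
      have h2 : j p.1 * p.2.out = j q.1 * q.2.out := h
      rw [h1] at h2
      exact Prod.ext (hi (mul_right_cancel h2)) h1
    · intro g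
      have : (((g : G ⧸ j.range).out : G) : G ⧸ j.range) = (g : G ⧸ j.range) := Quotient.out_eq _
      rw [QuotientGroup.eq] at this
      obtain ⟨z, hz⟩ := this
      refine ⟨(z, (g : G ⧸ j.range)), ?_⟩
      simp only [ψ]
      rw [(hj _ _).eq, hz]; group
  refine ⟨_, (Equiv.ofBijective ψ hψ).symm, fun z g => ?_⟩
  rw [Equiv.symm_apply_eq]
  obtain ⟨p, rfl⟩ := hψ.2 g
  have : (Equiv.ofBijective ψ hψ).symm (ψ p) = p := (Equiv.ofBijective ψ hψ).symm_apply_apply p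
  rw [this]
  change _ = j (z * p.1) * p.2.out
  rw [map_mul, mul_assoc]

lemma T_disp (hj : ∀ z g, Commute (j z) g)
    [Infinite G] (hi : Function.Injective j) (b : Bool) :
    ∃ p ∈ T j, ∀ x y, ∃ z, (p (b, x, y)).2.1 = j z := by
  classical
  obtain ⟨R, e, he⟩ := triv_eq hj hi
  have hRG : Cardinal.mk R ≤ Cardinal.mk G := by
    refine Cardinal.mk_le_of_injective (f := fun r => e.symm (1, r)) fun r r' h => ?_
    simpa using h
  have hne : Nonempty R := ⟨(e 1).2⟩
  have hG0 : Cardinal.aleph0 ≤ Cardinal.mk G := Cardinal.aleph0_le_mk G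
  have hRGc : Cardinal.mk (R × G) = Cardinal.mk G := by
    rw [Cardinal.mk_prod, Cardinal.lift_id, Cardinal.lift_id]
    exact Cardinal.mul_eq_right hG0 hRG (Cardinal.mk_ne_zero_iff.2 hne)
  have hX : Cardinal.mk (Bool × R × G) = Cardinal.mk G := by
    rw [Cardinal.mk_prod, Cardinal.lift_id, Cardinal.lift_id, hRGc]
    exact Cardinal.mul_eq_right hG0 (le_trans (Cardinal.mk_le_aleph0) hG0) (by simp)
  obtain ⟨cc⟩ : Nonempty (R × G ≃ G) := Cardinal.eq.1 hRGc
  let s : Set (Bool × R × G) := {v | v.1 = b}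
  let f : s ↪ Bool × R × G := ⟨fun v => (b, (e 1).2, cc v.1.2), by
    rintro ⟨⟨b1, v1⟩, h1⟩ ⟨⟨b2, v2⟩, h2⟩ h
    change b1 = b at h1
    change b2 = b at h2
    subst h1 h2
    simpa using h⟩
  have hc : ∀ t : Set (Bool × R × G), (∀ y : G, (!b, (e 1).2, y) ∈ t) →
      Cardinal.mk t = Cardinal.mk G := by
    intro t ht
    apply le_antisymm
    · rw [← hX]; exact Cardinal.mk_set_le t
    · refine Cardinal.mk_le_of_injective (f := fun y => (⟨_, ht y⟩ : t)) fun r r' h => ?_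
      simpa using h
  obtain ⟨q, hq⟩ := Cardinal.extend_function f (Cardinal.eq.1 (by
    rw [hc, hc]
    · rintro y ⟨v, hv⟩
      have h3 : b = !b := congrArg Prod.fst hv
      simp at h3
    · intro y h
      simp [s] at h))
  let E : Bool × G × G ≃ Z × (Bool × R × G) :=
    ⟨fun v => ((e v.2.1).1, v.1, (e v.2.1).2, v.2.2),
      fun v => (v.2.1, e.symm (v.1, v.2.2.1), v.2.2.2), fun v => by simp, fun v => by simp⟩
  let p : Equiv.Perm (Bool × G × G) := E.trans ((Equiv.prodCongrRight fun _ => q).trans E.symm)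
  have hE : ∀ z v, E.symm (z * v.1, v.2) = lam (j z) (E.symm v) := by
    intro z v
    rw [Equiv.symm_apply_eq]
    change _ = ((e (j z * e.symm (v.1, v.2.2.1))).1, v.2.1, (e (j z * e.symm (v.1, v.2.2.1))).2, _)
    rw [he]
    simp
    rfl
  refine ⟨p, mem_T'.2 fun z b x y => ?_, fun x y => ?_⟩
  · have h1 : E (b, j z * x, y) = (z * (E (b, x, y)).1, (E (b, x, y)).2) := by
      change ((e (j z * x)).1, b, (e (j z * x)).2, _) = _
      rw [he]
      rfl
    change E.symm ((E (b, j z * x, y)).1, q (E (b, j z * x, y)).2) = _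
    rw [h1]
    exact hE z ((E (b, x, y)).1, q (E (b, x, y)).2)
  · have h1 : q (b, (e x).2, y) = (b, (e 1).2, cc ((e x).2, y)) := hq ⟨(b, (e x).2, y), rfl⟩
    change ∃ z, (E.symm ((e x).1, q (b, (e x).2, y))).2.1 = j z
    rw [h1]
    change ∃ z, e.symm ((e x).1, (e 1).2) = j z
    refine ⟨(e x).1 * (e 1).1⁻¹, ?_⟩
    rw [Equiv.symm_apply_eq, ← mul_one (j _), he]
    simp

lemma T_normal [Infinite G] (hi : Function.Injective j) (K : Subgroup (T j)) [K.Normal] (g : G)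
    (hg : ∀ z, g ≠ j z) (hK : lamT hj g ∈ K) (h : G) : lamT hj h ∈ K := by
  have main : ∀ b, ∃ p : T j, p ∈ K ∧ (p : Equiv.Perm (Bool × G × G)) =
      sl (Pi.mulSingle b (Lm h)) := by
    intro b
    obtain ⟨p, hp, hpb⟩ := T_disp hj hi b
    have hm : ∀ s : Equiv.Perm (G × G), (∀ z v, s (Lm (j z) v) = Lm (j z) (s v)) →
        sl (Pi.mulSingle b s) ∈ T j := by
      intro s hs
      refine sl_mem _ fun b' z v => ?_
      by_cases e : b' = b
      · subst e; simp [hs]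
      · simp [Pi.mulSingle_eq_of_ne e]
    let x : T j := ⟨_, hm tm (tm_eq hj)⟩
    let x' : T j := ⟨_, hm (Fm h) (Fm_eq h)⟩
    have hk : (⟨p, hp⟩ : T j)⁻¹ * lamT hj g * (⟨p, hp⟩ : T j)⁻¹⁻¹ ∈ K :=
      Subgroup.Normal.conj_mem inferInstance _ hK _
    refine ⟨_, disp_comm K (x := x) (x' := x') hk ?_, ?_⟩
    · apply Subtype.ext
      refine (perm_disp {v | v.1 = b} (p⁻¹ * lam g * p⁻¹⁻¹) _ _ ?_ ?_ ?_).eq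
      · rintro ⟨b', u, w⟩ hb hu
        change b' = b at hb
        subst hb
        simp only [Equiv.Perm.coe_mul, Function.comp_apply, inv_inv, Set.mem_ofPred_eq] at hu
        obtain ⟨z, hz⟩ := hpb u w
        set v := p⁻¹ (lam g (p (b', u, w))) with hv
        have e : p v = lam g (p (b', u, w)) := by simp [hv]
        obtain ⟨z', hz'⟩ := hpb v.2.1 v.2.2
        have : (b', v.2.1, v.2.2) = v := by rw [← hu]
        rw [this, e, lam_apply] at hz'
        change g * (p (b', u, w)).2.1 = j z' at hz'
        rw [hz] at hz'
        apply hg (z' * z⁻¹)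
        rw [map_mul, ← hz', map_inv]; group
      · rintro v (hv : v.1 ≠ b)
        change (v.1, (Pi.mulSingle b _ : Bool → Equiv.Perm (G × G)) v.1 v.2) = v
        rw [Pi.mulSingle_eq_of_ne hv]; rfl
      · rintro v (hv : v.1 ≠ b)
        change (v.1, (Pi.mulSingle b _ : Bool → Equiv.Perm (G × G)) v.1 v.2) = v
        rw [Pi.mulSingle_eq_of_ne hv]; rfl
    · change sl _ * sl _ * (sl _)⁻¹ * (sl _)⁻¹ = _
      rw [← map_inv, ← map_inv, ← map_mul, ← map_mul, ← map_mul, ← Pi.mulSingle_inv,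
        ← Pi.mulSingle_inv, ← Pi.mulSingle_mul, ← Pi.mulSingle_mul, ← Pi.mulSingle_mul, tm_conj]
      congr 2
      group
  obtain ⟨p1, h1, e1⟩ := main true
  obtain ⟨p2, h2, e2⟩ := main false
  have : lamT hj h = p1 * p2 := by
    apply Subtype.ext
    change sl (fun _ => Lm h) = (p1 : Equiv.Perm (Bool × G × G)) * (p2 : Equiv.Perm (Bool × G × G))
    rw [e1, e2, ← map_mul]
    congr 1
    funext b
    cases b <;> simp
  rw [this]
  exact K.mul_mem h1 h2

end T
end Rz


open CategoryTheory AlgebraicTopology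

namespace Rz

theorem exists_limit (G : ℕ → Type) [∀ n, Group (G n)] (f : ∀ n, G n →* G (n + 1))
    (hf : ∀ n, Function.Injective (f n)) : ∃ (Γ : Type) (_ : Group Γ) (α : ∀ n, G n →* Γ),
    (∀ n, Function.Injective (α n)) ∧ (∀ n g, α (n + 1) (f n g) = α n g) ∧
      ∀ x, ∃ n g, α n g = x := by
  let F : ∀ m n : ℕ, m ≤ n → (G m →* G n) := fun m n h =>
    Nat.leRecOn h (fun {k} g => (f k).comp g) (MonoidHom.id (G m))
  have F1 : ∀ m h, F m m h = MonoidHom.id _ := fun m h => Nat.leRecOn_self _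
  have F2 : ∀ m n (h : m ≤ n) (h' : m ≤ n + 1), F m (n + 1) h' = (f n).comp (F m n h) :=
    fun m n h h' => Nat.leRecOn_succ h _
  have F3 : ∀ m n (h : m ≤ n) k (h' : n ≤ k) x, F n k h' (F m n h x) = F m k (h.trans h') x := by
    intro m n h k h'
    induction k, h' using Nat.le_induction with
    | base => intro x; rw [F1]; rfl
    | succ k hk ih =>
      intro x
      rw [F2 n k hk, F2 m k (h.trans hk), MonoidHom.comp_apply, ih, MonoidHom.comp_apply]
  have F4 : ∀ m n (h : m ≤ n), Function.Injective (F m n h) := by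
    intro m n h
    induction n, h using Nat.le_induction with
    | base => rw [F1]; exact fun x y h => h
    | succ k hk ih =>
      rw [F2 m k hk]
      exact (hf k).comp ih
  have : DirectedSystem G (F · · ·) :=
    ⟨fun i x => by rw [F1]; rfl, fun k j i hij hjk x => F3 _ _ _ _ _ _⟩
  refine ⟨DirectLimit G F, inferInstance, fun n => ⟨⟨fun g => ⟦⟨n, g⟩⟧, ?_⟩, ?_⟩, ?_, ?_, ?_⟩
  · exact (DirectLimit.one_def n).symm
  · intro x y
    exact (DirectLimit.mul_def n x y).symm
  · intro n
    exact DirectLimit.mk_injective F F4 n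
  · intro n g
    have h : f n g = F n (n + 1) (Nat.le_succ n) g := by rw [F2 n n le_rfl, F1]; rfl
    rw [h]
    exact DirectLimit.mk_apply n (n + 1) g (Nat.le_succ n)
  · intro x
    obtain ⟨n, g, h⟩ := DirectLimit.exists_eq_mk F x
    exact ⟨n, g, h.symm⟩

structure Stage (Z : Type) [CommGroup Z] : Type 1 where
  G : Type
  grp : Group G
  j : Z →* G
  inj : Function.Injective j
  cent : ∀ g, (∀ h, Commute g h) ↔ ∃ z, j z = g
  inf : Infinite G

variable {Z : Type} [CommGroup Z]

instance (s : Stage Z) : Group s.G := s.grp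
instance (s : Stage Z) : Infinite s.G := s.inf

lemma Stage.hj (s : Stage Z) : ∀ z g, Commute (s.j z) g := fun z => (s.cent _).2 ⟨z, rfl⟩

def Stage.next (s : Stage Z) : Stage Z where
  G := T s.j
  grp := inferInstance
  j := (lamT s.hj).comp s.j
  inj := (lamT_inj s.hj).comp s.inj
  cent := by
    intro g
    constructor
    · intro h
      obtain ⟨c0, h1, h2⟩ := T_center s.hj g h
      obtain ⟨z, rfl⟩ := (s.cent c0).1 h1
      exact ⟨z, h2⟩
    · rintro ⟨z, rfl⟩ h
      exact lamT_cent s.hj z h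
  inf := Infinite.of_injective _ (lamT_inj s.hj)

lemma perm_center (p : Equiv.Perm ℕ) (h : ∀ q, Commute p q) : p = 1 := by
  ext1 a
  by_contra hne
  have hne : p a ≠ a := hne
  obtain ⟨c, hc⟩ := Infinite.exists_notMem_finset ({a, p a} : Finset ℕ)
  simp only [Finset.mem_insert, Finset.mem_singleton, not_or] at hc
  have := Equiv.congr_fun (h (Equiv.swap (p a) c)).eq a
  simp only [Equiv.Perm.coe_mul, Function.comp_apply] at this
  rw [Equiv.swap_apply_of_ne_of_ne (Ne.symm hne) (Ne.symm hc.1), Equiv.swap_apply_left] at this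
  exact hc.2 this.symm

def Stage.zero (Z : Type) [CommGroup Z] : Stage Z where
  G := Z × (ℕ → Equiv.Perm ℕ)
  grp := inferInstance
  j := MonoidHom.inl _ _
  inj := fun x y h => congrArg Prod.fst h
  cent := by
    rintro ⟨z, p⟩
    constructor
    · intro h
      refine ⟨z, ?_⟩
      have : p = 1 := by
        funext i
        refine perm_center _ fun q => ?_
        have := congrArg (fun x : Z × (ℕ → Equiv.Perm ℕ) => x.2 i) (h (1, fun _ => q)).eq
        exact this
      rw [this]; rfl
    · rintro ⟨z', h⟩ ⟨y, q⟩
      have h1 := congrArg Prod.snd h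
      change 1 = p at h1
      rw [← h1]
      exact Prod.ext (mul_comm _ _) (by simp)
  inf := by
    refine Infinite.of_injective (fun n : ℕ => ((1 : Z), Pi.mulSingle n (Equiv.swap 0 1))) ?_
    intro n m h
    have h1 := congrArg (fun x : Z × (ℕ → Equiv.Perm ℕ) => x.2 n) h
    by_contra hne
    simp only [Pi.mulSingle_eq_same, Pi.mulSingle_eq_of_ne hne] at h1
    simpa using Equiv.congr_fun h1 0

noncomputable def tower (Z : Type) [CommGroup Z] : ℕ → Stage Z
  | 0 => Stage.zero Z
  | n + 1 => (tower Z n).next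

theorem exists_gamma (Z : Type) [CommGroup Z] : ∃ (Γ : Type) (_ : Group Γ) (j : Z →* Γ)
    (ι : (ℕ → Equiv.Perm ℕ) →* Γ), Function.Injective j ∧
    (∀ g, (∀ h, Commute g h) ↔ ∃ z, j z = g) ∧ Binate Γ ∧
    (∀ g, (∀ z, j z ≠ g) → ∀ K : Subgroup Γ, K.Normal → g ∈ K → K = ⊤) ∧
    (∀ p z, ι p = j z → p = 1) := by
  let S := tower Z
  let l : ∀ n, (S n).G →* (S (n + 1)).G := fun n => lamT (S n).hj
  have hl : ∀ n, Function.Injective (l n) := fun n => lamT_inj _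
  have hjl : ∀ n z, (S (n + 1)).j z = l n ((S n).j z) := fun n z => rfl
  have hm : ∀ n, Mit (l n) := fun n => lamT_mit _
  obtain ⟨Γ, _, α, h1, h2, h3⟩ := exists_limit (fun n => (S n).G) l hl
  let j : Z →* Γ := (α 0).comp (S 0).j
  have hαj : ∀ n z, α n ((S n).j z) = j z := by
    intro n z
    induction n with
    | zero => rfl
    | succ n ih => rw [hjl, h2, ih]
  have mono : ∀ n m, n ≤ m → ∀ g, ∃ g', α m g' = α n g := by
    intro n m h
    induction m, h using Nat.le_induction with
    | base => exact fun g => ⟨g, rfl⟩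
    | succ m hm ih =>
      intro g
      obtain ⟨g', hg'⟩ := ih g
      exact ⟨l m g', by rw [h2, hg']⟩
  have hch : ∀ r n, Chain Γ r (S n).G (α n) := by
    intro r
    induction r with
    | zero => intro n; trivial
    | succ r ih =>
      intro n
      exact ⟨(S (n + 1)).G, inferInstance, l n, α (n + 1), by ext g; exact (h2 n g).symm,
        hm n, ih (n + 1)⟩
  refine ⟨Γ, inferInstance, j, (α 0).comp (MonoidHom.inr Z (ℕ → Equiv.Perm ℕ)),
    (h1 0).comp (S 0).inj, ?_, ?_, ?_, ?_⟩
  · intro g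
    constructor
    · intro h
      obtain ⟨n, g, rfl⟩ := h3 g
      obtain ⟨z, rfl⟩ := ((S n).cent g).1 fun x => h1 n (by
        rw [map_mul, map_mul]; exact (h (α n x)).eq)
      exact ⟨z, (hαj n z).symm⟩
    · rintro ⟨z, rfl⟩ h
      obtain ⟨n, h, rfl⟩ := h3 h
      rw [← hαj n]
      exact ((S n).hj z h).map (α n)
  · intro F
    obtain ⟨n, hn⟩ : ∃ n, ∀ x ∈ F, ∃ g, α n g = x := by
      classical
      induction F using Finset.induction_on with
      | empty => exact ⟨0, fun x hx => absurd hx (by simp)⟩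
      | insert a s ha ih =>
        obtain ⟨n, hn⟩ := ih
        obtain ⟨m, g, rfl⟩ := h3 a
        refine ⟨max n m, fun x hx => ?_⟩
        rcases Finset.mem_insert.1 hx with rfl | hx
        · exact mono _ _ (le_max_right n m) g
        · obtain ⟨g, rfl⟩ := hn x hx
          exact mono _ _ (le_max_left n m) g
    exact ⟨(S n).G, inferInstance, α n, h1 n, hn, hch 4 n⟩
  · intro g hg K hK hgK
    obtain ⟨n, g, rfl⟩ := h3 g
    have main : ∀ m, n ≤ m → ∀ h, α m h ∈ K := by
      intro m hnm h
      obtain ⟨g', hg'⟩ := mono n m hnm g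
      rw [← h2]
      have hn : (K.comap (α (m + 1))).Normal := hK.comap _
      refine @T_normal _ _ _ _ _ (S m).hj _ (S m).inj (K.comap (α (m + 1))) hn g' (fun z e => hg z ?_) ?_ h
      · rw [← hαj m, ← hg', e]
      · change α (m + 1) (l m g') ∈ K
        rw [h2, hg']; exact hgK
    rw [Subgroup.eq_top_iff']
    intro x
    obtain ⟨m, h, rfl⟩ := h3 x
    obtain ⟨h', e⟩ := mono m (max n m) (le_max_right _ _) h
    rw [← e]
    exact main _ (le_max_left _ _) _
  · intro p z h
    have := h1 0 h
    exact congrArg Prod.snd this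

end Rz


open CategoryTheory AlgebraicTopology

namespace Rz

def NoRep (S : Type) [Group S] : Prop :=
  ∀ (V : Type) [AddCommGroup V] [Module ℂ V] [FiniteDimensional ℂ V]
        (ρ : S →* LinearMap.GeneralLinearGroup ℂ V) (s : S), ρ s = 1

lemma rep_comm {V : Type} [AddCommGroup V] [Module ℂ V] [FiniteDimensional ℂ V]
    (a b : ℕ → LinearMap.GeneralLinearGroup ℂ V) (h : ∀ i j, i < j → Commute (a j) (b i)) :
    ∃ i, Commute (a i) (b i) := by
  let W : ℕ →o (Submodule ℂ (Module.End ℂ V))ᵒᵈ :=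
    { toFun := fun n => OrderDual.toDual
        (Subalgebra.toSubmodule (Subalgebra.centralizer ℂ
          {x : Module.End ℂ V | ∃ i < n, (b i : Module.End ℂ V) = x}))
      monotone' := by
        intro m n hmn
        show Subalgebra.toSubmodule _ ≤ Subalgebra.toSubmodule _
        intro x hx
        rw [Subalgebra.mem_toSubmodule, Subalgebra.mem_centralizer_iff] at hx ⊢
        rintro y ⟨i, hi, rfl⟩
        exact hx _ ⟨i, by omega, rfl⟩ }
  obtain ⟨n, hn⟩ := IsArtinian.monotone_stabilizes W
  have e := hn (n + 1) (by omega)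
  have h1 : (a n : Module.End ℂ V) ∈ Subalgebra.toSubmodule (Subalgebra.centralizer ℂ
          {x : Module.End ℂ V | ∃ i < n, (b i : Module.End ℂ V) = x}) := by
    rw [Subalgebra.mem_toSubmodule, Subalgebra.mem_centralizer_iff]
    rintro y ⟨i, hi, rfl⟩
    have := h i n hi
    exact_mod_cast this.eq.symm
  have h2 : (a n : Module.End ℂ V) ∈ Subalgebra.toSubmodule (Subalgebra.centralizer ℂ
          {x : Module.End ℂ V | ∃ i < n + 1, (b i : Module.End ℂ V) = x}) := by
    have e' := congrArg OrderDual.ofDual e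
    exact e' ▸ h1
  rw [Subalgebra.mem_toSubmodule, Subalgebra.mem_centralizer_iff] at h2
  refine ⟨n, ?_⟩
  have := h2 _ ⟨n, by omega, rfl⟩
  exact (by exact_mod_cast this.symm : a n * b n = b n * a n)

lemma free_perm (X : Type) [Countable X] [Infinite X] (n : ℕ) (hn : 2 ≤ n) :
    ∃ σ : Equiv.Perm X, σ ^ n = 1 ∧ (∀ k, ¬ n ∣ k → ∀ x, (σ ^ k) x ≠ x) ∧
      ∃ P : Set X, P.Infinite ∧ ∀ x ∈ P, σ x ∉ P := by
  have : NeZero n := ⟨by omega⟩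
  have : Infinite (ZMod n × ℕ) := inferInstance
  obtain ⟨e⟩ := nonempty_equiv_of_countable (α := X) (β := ZMod n × ℕ)
  let τ : Equiv.Perm (ZMod n × ℕ) := (Equiv.addRight (1 : ZMod n)).prodCongr (Equiv.refl ℕ)
  have hτ : ∀ (k : ℕ) x, (τ ^ k) x = (x.1 + k, x.2) := by
    intro k
    induction k with
    | zero => intro x; simp
    | succ k ih =>
      intro x
      rw [pow_succ', Equiv.Perm.mul_apply, ih]
      simp [τ, add_assoc]
  have hc : ∀ (k : ℕ) x, ((e.symm.permCongr τ) ^ k) x = e.symm ((τ ^ k) (e x)) := by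
    intro k
    induction k with
    | zero => intro x; simp
    | succ k ih =>
      intro x
      rw [pow_succ', Equiv.Perm.mul_apply, ih, pow_succ', Equiv.Perm.mul_apply]
      simp [Equiv.permCongr_apply]
  refine ⟨e.symm.permCongr τ, ?_, ?_, {x | (e x).1 = 0}, ?_, ?_⟩
  · ext x
    rw [hc, hτ]
    simp
  · intro k hk x hx
    rw [hc, hτ, Equiv.symm_apply_eq] at hx
    have := congrArg Prod.fst hx
    simp only [add_eq_left] at this
    exact hk ((ZMod.natCast_eq_zero_iff k n).1 this)
  · refine Set.infinite_of_injective_forall_mem (f := fun k : ℕ => e.symm (0, k)) ?_ ?_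
    · intro k l h
      exact (Prod.mk.inj (e.symm.injective h)).2
    · intro k
      simp
  · intro x hx hx'
    have h1 := hc 1 x
    rw [hτ, pow_one] at h1
    rw [Set.mem_ofPred_eq] at hx hx'
    rw [h1, Equiv.apply_symm_apply] at hx'
    simp only [hx, Nat.cast_one, zero_add] at hx'
    have h2 : ((1 : ℕ) : ZMod n) = 0 := by simpa using hx'
    rw [ZMod.natCast_eq_zero_iff, Nat.dvd_one] at h2
    omega

lemma orderOf_eq_of {G : Type} [Group G] (g : G) (n : ℕ) (h : g ^ n = 1)
    (h' : ∀ k, ¬ n ∣ k → g ^ k ≠ 1) : orderOf g = n :=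
  Nat.dvd_antisymm (orderOf_dvd_of_pow_eq_one h)
    (by by_contra hk; exact h' _ hk (pow_orderOf_eq_one g))

def GG (Γ : Type) [Group Γ] (n : ℕ) : Prop := ∃ g : Γ, orderOf g = n ∧
  ∀ K : Subgroup Γ, K.Normal → g ∈ K → K = ⊤

theorem exists_K1 (A B : Type) [AddCommGroup A] [AddCommGroup B] :
    ∃ (K : Type) (_ : Group K) (κ : K → K → B), A1 K ∧ A3 K ∧ U2 K B κ ∧
      Nonempty (Subgroup.center K ≃* Multiplicative A) ∧ (∀ n ≥ 2, GG K n) ∧ NoRep K := by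
  obtain ⟨Γ, _, j, ι, hj, hcen, hbin, hnc, hι⟩ :=
    exists_gamma (Multiplicative A × Multiplicative B)
  have hjc : ∀ z g, Commute (j z) g := fun z => (hcen _).2 ⟨z, rfl⟩
  let jB : Multiplicative B →* Γ := j.comp (MonoidHom.inr _ _)
  have hjB : Function.Injective jB := hj.comp (fun x y h => (Prod.mk.inj h).2)
  let N : Subgroup Γ := jB.range
  have : N.Normal := ⟨by
    rintro _ ⟨b, rfl⟩ g
    refine ⟨b, ?_⟩
    have : Commute (jB b) g := hjc _ g
    rw [← this.eq, mul_inv_cancel_right]⟩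
  let π : Γ →* Γ ⧸ N := QuotientGroup.mk' N
  have hπ : Function.Surjective π := QuotientGroup.mk'_surjective N
  have hker : ∀ e, π e = 1 ↔ ∃ b, jB b = e := fun e => QuotientGroup.eq_one_iff e
  have h1 := hbin.a1
  have h2 := hbin.a2
  have h3 := hbin.a3
  choose s hs using hπ
  have hκ : ∀ x y, ∃ b : B, s x * s y = jB (Multiplicative.ofAdd b) * s (x * y) := by
    intro x y
    obtain ⟨b, hb⟩ := (hker (s x * s y * (s (x * y))⁻¹)).1 (by simp [hs])
    exact ⟨Multiplicative.toAdd b, by rw [ofAdd_toAdd, hb]; group⟩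
  choose κ hκ using hκ
  have hπ : Function.Surjective π := QuotientGroup.mk'_surjective N
  have hN : ∀ g, (∀ z, j z ≠ g) → ∀ K : Subgroup (Γ ⧸ N), K.Normal → π g ∈ K → K = ⊤ := by
    intro g hg K hK hgK
    have := hnc g hg (K.comap π) (hK.comap π) hgK
    rw [eq_top_iff]
    rintro x -
    obtain ⟨y, rfl⟩ := hπ x
    exact (this ▸ Subgroup.mem_top y : y ∈ K.comap π)
  refine ⟨Γ ⧸ N, inferInstance, κ, h1.quot hπ, central_a3 hπ jB (fun b => hjc _) hker hjB h1 h3,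
    central_u2 jB (fun b => hjc _) hker hjB h1 h2 s hs κ hκ, ?_, ?_, ?_⟩
  · have hx : ∀ x, (∀ e, Commute (π x) (π e)) → ∃ z, j z = x := by
      intro x hx
      have hin : ∀ e, x * e * x⁻¹ * e⁻¹ ∈ Subgroup.center Γ := by
        intro e
        have : π (x * e * x⁻¹ * e⁻¹) = 1 := by
          simp only [map_mul, map_inv]
          rw [(hx e).eq]; group
        obtain ⟨b, hb⟩ := (hker _).1 this
        rw [← hb, Subgroup.mem_center_iff]
        exact fun g => (hjc _ g).eq.symm
      let f : Γ →* Subgroup.center Γ := MonoidHom.mk' (fun e => ⟨_, hin e⟩) (by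
        intro e e'
        apply Subtype.ext
        show x * (e * e') * x⁻¹ * (e * e')⁻¹ = (x * e * x⁻¹ * e⁻¹) * (x * e' * x⁻¹ * e'⁻¹)
        have := Subgroup.mem_center_iff.1 (hin e') e
        calc x * (e * e') * x⁻¹ * (e * e')⁻¹
            = x * e * x⁻¹ * ((x * e' * x⁻¹ * e'⁻¹)) * e⁻¹ := by group
          _ = x * e * x⁻¹ * e⁻¹ * (e * (x * e' * x⁻¹ * e'⁻¹)) * e⁻¹ := by group
          _ = _ := by rw [this]; group)
      refine (hcen x).1 fun h => ?_
      let cg : CommGroup (Subgroup.center Γ) := { (inferInstance : Group (Subgroup.center Γ)) with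
        mul_comm := fun a b => Subtype.ext (Subgroup.mem_center_iff.1 b.2 a.1) }
      have := congrArg Subtype.val (A1.hom (N := Subgroup.center Γ) h1 f h)
      have h4 : x * h * x⁻¹ * h⁻¹ = 1 := this
      rw [mul_inv_eq_one, mul_inv_eq_iff_eq_mul] at h4
      exact h4
    let f : Multiplicative A →* Subgroup.center (Γ ⧸ N) := MonoidHom.mk'
      (fun a => ⟨π (j (a, 1)), by
        rw [Subgroup.mem_center_iff]
        intro g
        obtain ⟨g, rfl⟩ := hπ g
        rw [← map_mul, ← map_mul, (hjc _ g).eq]⟩) (by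
        intro a a'
        apply Subtype.ext
        show π (j (a * a', 1)) = π (j (a, 1)) * π (j (a', 1))
        rw [← map_mul, ← map_mul]; simp)
    refine ⟨(MulEquiv.ofBijective f ⟨?_, ?_⟩).symm⟩
    · rw [injective_iff_map_eq_one]
      intro a ha
      obtain ⟨b, hb⟩ := (hker _).1 (congrArg Subtype.val ha)
      have := hj hb
      exact (Prod.mk.inj this).1.symm
    · rintro ⟨x, hxc⟩
      obtain ⟨x, rfl⟩ := hπ x
      obtain ⟨⟨a, b⟩, rfl⟩ := hx x (fun e => (Subgroup.mem_center_iff.1 hxc _).symm)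
      refine ⟨a, Subtype.ext ?_⟩
      show π (j (a, 1)) = π (j (a, b))
      have : (a, b) = ((a, 1) : Multiplicative A × Multiplicative B) * (1, b) := by simp
      rw [this, map_mul, map_mul, (hker (j (1, b))).2 ⟨b, rfl⟩, mul_one]
  · intro n hn
    obtain ⟨σ, hσ, hσ', -⟩ := free_perm ℕ n hn
    have hne : ∀ k, ¬ n ∣ k → ∀ z, j z ≠ ι (fun _ => σ ^ k) := by
      intro k hk z hz
      have := congrFun (hι _ _ hz.symm) 0
      exact hσ' k hk 0 (by simp [this])
    refine ⟨π (ι fun _ => σ), orderOf_eq_of _ _ ?_ ?_, ?_⟩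
    · rw [← map_pow, ← map_pow]
      have : (fun _ : ℕ => σ) ^ n = 1 := by funext; simp [hσ]
      rw [this, map_one, map_one]
    · intro k hk h
      rw [← map_pow, ← map_pow, hker] at h
      obtain ⟨b, hb⟩ := h
      exact hne k hk _ hb
    · refine hN _ ?_
      have := hne 1 (by rw [Nat.dvd_one]; omega)
      simpa using this
  · intro V _ _ _ ρ s
    let a : ℕ → Γ := fun i => ι (Pi.mulSingle i (Equiv.swap 0 1))
    let b : ℕ → Γ := fun i => ι (Pi.mulSingle i (Equiv.swap 1 2))
    obtain ⟨i, hi⟩ := rep_comm (fun i => ρ (π (a i))) (fun i => ρ (π (b i))) (by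
      intro i j hij
      have : Commute (Pi.mulSingle j (Equiv.swap 0 1) : ℕ → Equiv.Perm ℕ)
        (Pi.mulSingle i (Equiv.swap 1 2)) := Pi.mulSingle_commute hij.ne' _ _
      exact ((this.map ι).map π).map ρ)
    have hk : ρ.ker = ⊤ := by
      refine hN (a i * b i * (a i)⁻¹ * (b i)⁻¹) ?_ _ inferInstance ?_
      · intro z hz
        simp only [a, b, ← map_mul, ← map_inv] at hz
        have h5 := congrFun (hι _ _ hz.symm) i
        simp only [Pi.mul_apply, Pi.inv_apply, Pi.mulSingle_eq_same, Pi.one_apply] at h5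
        have h6 := congrArg (fun p : Equiv.Perm ℕ => p 0) h5
        revert h6
        simp only [Equiv.swap_inv, Equiv.Perm.mul_apply, Equiv.Perm.one_apply]
        decide
      · rw [MonoidHom.mem_ker]
        simp only [map_mul, map_inv]
        rw [hi.eq]; group
    exact MonoidHom.mem_ker.1 (hk ▸ Subgroup.mem_top s)

end Rz


open CategoryTheory AlgebraicTopology

namespace Rz

@[ext] structure Wr (Y G : Type) where
  perm : Equiv.Perm Y
  fn : Y → G

section WrGroup
variable {Y G : Type} [Group G]

instance : Mul (Wr Y G) := ⟨fun a b => ⟨a.perm * b.perm, fun y => a.fn y * b.fn (a.perm.symm y)⟩⟩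
instance : One (Wr Y G) := ⟨⟨1, fun _ => 1⟩⟩
instance : Inv (Wr Y G) := ⟨fun a => ⟨a.perm⁻¹, fun y => (a.fn (a.perm y))⁻¹⟩⟩

@[simp] lemma Wr.mul_perm (a b : Wr Y G) : (a * b).perm = a.perm * b.perm := rfl
@[simp] lemma Wr.mul_fn (a b : Wr Y G) (y : Y) :
    (a * b).fn y = a.fn y * b.fn (a.perm.symm y) := rfl
@[simp] lemma Wr.one_perm : (1 : Wr Y G).perm = 1 := rfl
@[simp] lemma Wr.one_fn (y : Y) : (1 : Wr Y G).fn y = 1 := rfl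
@[simp] lemma Wr.inv_perm (a : Wr Y G) : (a⁻¹).perm = a.perm⁻¹ := rfl
@[simp] lemma Wr.inv_fn (a : Wr Y G) (y : Y) : (a⁻¹).fn y = (a.fn (a.perm y))⁻¹ := rfl

instance : Group (Wr Y G) := Group.ofLeftAxioms
  (by
    intro a b c
    refine Wr.ext (mul_assoc _ _ _) (funext fun y => ?_)
    simp only [Wr.mul_fn, mul_assoc]
    rfl)
  (by
    intro a
    refine Wr.ext (one_mul _) (funext fun y => ?_)
    simp only [Wr.mul_fn, Wr.one_fn, one_mul]
    rfl)
  (by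
    intro a
    refine Wr.ext (inv_mul_cancel _) (funext fun y => ?_)
    simp only [Wr.mul_fn, Wr.inv_fn, Wr.one_fn]
    exact inv_mul_cancel _)

def pp : Equiv.Perm Y →* Wr Y G where
  toFun σ := ⟨σ, fun _ => 1⟩
  map_one' := rfl
  map_mul' σ τ := Wr.ext rfl (funext fun y => by simp)

@[simp] lemma pp_perm (σ : Equiv.Perm Y) : (pp σ : Wr Y G).perm = σ := rfl
@[simp] lemma pp_fn (σ : Equiv.Perm Y) (y : Y) : (pp σ : Wr Y G).fn y = 1 := rfl

def permHom : Wr Y G →* Equiv.Perm Y where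
  toFun a := a.perm
  map_one' := rfl
  map_mul' _ _ := rfl

def Fx (a : Wr Y G) (y : Y) : Prop := a.perm y = y ∧ a.fn y = 1

lemma Fx.symm {a : Wr Y G} {y : Y} (h : Fx a y) : a.perm.symm y = y := by
  rw [Equiv.symm_apply_eq]; exact h.1.symm

lemma Fx.mul {a b : Wr Y G} {y : Y} (h : Fx a y) (h' : Fx b y) : Fx (a * b) y := by
  refine ⟨?_, ?_⟩
  · rw [Wr.mul_perm, Equiv.Perm.mul_apply, h'.1, h.1]
  · rw [Wr.mul_fn, h.symm, h.2, h'.2, one_mul]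

lemma Fx.inv {a : Wr Y G} {y : Y} (h : Fx a y) : Fx a⁻¹ y :=
  ⟨h.symm, by rw [Wr.inv_fn, h.1, h.2, inv_one]⟩

lemma Fx.one (y : Y) : Fx (1 : Wr Y G) y := ⟨rfl, rfl⟩

lemma comm_of_fx {a b : Wr Y G} (h : ∀ y, Fx a y ∨ Fx b y) : Commute a b := by
  have key : ∀ {a b : Wr Y G}, (∀ y, Fx a y ∨ Fx b y) → ∀ y, Fx a y →
      a.perm (b.perm y) = b.perm (a.perm y) ∧
      a.fn y * b.fn (a.perm.symm y) = b.fn y * a.fn (b.perm.symm y) := by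
    intro a b h y hy
    rw [hy.symm, hy.1, hy.2, one_mul]
    constructor
    · rcases h (b.perm y) with h1 | h1
      · exact h1.1
      · have := b.perm.injective h1.1
        rw [this, hy.1]
    · rcases h (b.perm.symm y) with h1 | h1
      · rw [h1.2, mul_one]
      · have h2 := h1.1
        rw [Equiv.apply_symm_apply] at h2
        rw [← h2, hy.2, mul_one]
  have h' : ∀ y, Fx b y ∨ Fx a y := fun y => (h y).symm
  refine Wr.ext (Equiv.ext fun y => ?_) (funext fun y => ?_)
  · rcases h y with hy | hy
    · exact (key h y hy).1
    · exact (key h' y hy).1.symm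
  · rcases h y with hy | hy
    · exact (key h y hy).2
    · exact (key h' y hy).2.symm

end WrGroup

abbrev YY : Type := ℕ →₀ ℤ
def W (m : ℕ) : Set YY := {y | ∀ i, m ≤ i → y i = 0}

lemma W_mono {m n : ℕ} (h : m ≤ n) : W m ⊆ W n := fun _ hy i hi => hy i (h.trans hi)

lemma exists_W (y : YY) : ∃ m, y ∈ W m := by
  refine ⟨y.support.sup id + 1, fun i hi => ?_⟩
  by_contra h
  have := Finset.le_sup (f := id) (Finsupp.mem_support_iff.2 h)
  simp only [id] at this
  omega

section E2
variable {G : Type} [Group G]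

def HH (G : Type) [Group G] (m : ℕ) : Subgroup (Wr YY G) where
  carrier := {a | ∀ y, y ∉ W m → Fx a y}
  mul_mem' ha hb y hy := (ha y hy).mul (hb y hy)
  one_mem' y _ := Fx.one y
  inv_mem' ha y hy := (ha y hy).inv

lemma HH_mono {m n : ℕ} (h : m ≤ n) : HH G m ≤ HH G n :=
  fun _ ha y hy => ha y (fun hy' => hy (W_mono h hy'))

def EE (G : Type) [Group G] : Subgroup (Wr YY G) where
  carrier := {a | ∃ m, a ∈ HH G m}
  mul_mem' := by
    rintro a b ⟨m, ha⟩ ⟨n, hb⟩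
    exact ⟨max m n, mul_mem (HH_mono (le_max_left _ _) ha) (HH_mono (le_max_right _ _) hb)⟩
  one_mem' := ⟨0, one_mem _⟩
  inv_mem' := fun ⟨m, ha⟩ => ⟨m, inv_mem ha⟩

lemma HH_le_EE (m : ℕ) : HH G m ≤ EE G := fun _ ha => ⟨m, ha⟩

lemma perm_mem_W {m : ℕ} {a : Wr YY G} (ha : a ∈ HH G m) {y : YY} (hy : y ∈ W m) :
    a.perm y ∈ W m := by
  by_contra h
  have := a.perm.injective (ha _ h).1
  rw [this] at h
  exact h hy

lemma erase_mem {m : ℕ} {y : YY} (hy : y ∈ W (m + 1)) : y.erase m ∈ W m := by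
  intro i hi
  rcases eq_or_ne i m with rfl | h
  · simp
  · rw [Finsupp.erase_ne h]
    exact hy i (by omega)

lemma add_single_mem {m : ℕ} {y : YY} (hy : y ∈ W m) (k : ℤ) :
    y + Finsupp.single m k ∈ W (m + 1) := by
  intro i hi
  rw [Finsupp.add_apply, hy i (by omega), Finsupp.single_eq_of_ne (by omega), add_zero]

lemma add_single_at {m : ℕ} {y : YY} (hy : y ∈ W m) (k : ℤ) :
    (y + Finsupp.single m k : YY) m = k := by
  rw [Finsupp.add_apply, hy m le_rfl]; simp

lemma erase_add_single {m : ℕ} {y : YY} (hy : y ∈ W m) (k : ℤ) :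
    (y + Finsupp.single m k : YY).erase m = y := by
  ext i
  rcases eq_or_ne i m with rfl | h
  · simp [hy i le_rfl]
  · simp [Finsupp.erase_ne h]

open Classical in
noncomputable def thf (m : ℕ) (s : ℤ → HH G m) (y : YY) : YY :=
  if y ∈ W (m + 1) then (s (y m)).1.perm (y.erase m) + Finsupp.single m (y m) else y

lemma thf_mem {m : ℕ} (s : ℤ → HH G m) {y : YY} (hy : y ∈ W (m + 1)) :
    thf m s y = (s (y m)).1.perm (y.erase m) + Finsupp.single m (y m) := if_pos hy

lemma thf_not {m : ℕ} (s : ℤ → HH G m) {y : YY} (hy : y ∉ W (m + 1)) : thf m s y = y := if_neg hy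

lemma thf_mul {m : ℕ} (s s' : ℤ → HH G m) (y : YY) : thf m s (thf m s' y) = thf m (s * s') y := by
  by_cases hy : y ∈ W (m + 1)
  · have h1 := perm_mem_W (s' (y m)).2 (erase_mem hy)
    rw [thf_mem s' hy, thf_mem s (add_single_mem h1 _), add_single_at h1, erase_add_single h1,
      thf_mem _ hy]
    rfl
  · rw [thf_not _ hy, thf_not _ hy, thf_not _ hy]

lemma thf_one {m : ℕ} (y : YY) : thf m (1 : ℤ → HH G m) y = y := by
  by_cases hy : y ∈ W (m + 1)
  · rw [thf_mem _ hy]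
    exact Finsupp.erase_add_single _ _
  · simp only [thf, if_neg hy]

noncomputable def thp (m : ℕ) (s : ℤ → HH G m) : Equiv.Perm YY where
  toFun := thf m s
  invFun := thf m s⁻¹
  left_inv y := by rw [thf_mul, inv_mul_cancel, thf_one]
  right_inv y := by rw [thf_mul, mul_inv_cancel, thf_one]

open Classical in
noncomputable def th (m : ℕ) : (ℤ → HH G m) →* HH G (m + 1) := MonoidHom.mk'
  (fun s => ⟨⟨thp m s, fun y => if y ∈ W (m + 1) then (s (y m)).1.fn (y.erase m) else 1⟩, by
    intro y hy
    exact ⟨if_neg hy, if_neg hy⟩⟩) (by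
    intro s s'
    refine Subtype.ext (Wr.ext (Equiv.ext fun y => (thf_mul s s' y).symm) (funext fun y => ?_))
    show (if y ∈ W (m + 1) then _ else _) = (if y ∈ W (m + 1) then _ else _) *
      (if thf m s⁻¹ y ∈ W (m + 1) then (s' ((thf m s⁻¹ y) m)).1.fn ((thf m s⁻¹ y).erase m) else 1)
    by_cases hy : y ∈ W (m + 1)
    · have h1 := perm_mem_W (s⁻¹ (y m)).2 (erase_mem hy)
      rw [thf_mem _ hy, if_pos hy, if_pos hy, if_pos (add_single_mem h1 _), add_single_at h1,
        erase_add_single h1]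
      rfl
    · simp only [thf, if_neg hy, mul_one])

lemma th_perm (m : ℕ) (s : ℤ → HH G m) (y : YY) : (th m s).1.perm y = thf m s y := rfl
lemma th_fn (m : ℕ) (s : ℤ → HH G m) {y : YY} (hy : y ∈ W (m + 1)) :
    (th m s).1.fn y = (s (y m)).1.fn (y.erase m) := if_pos hy

lemma th_single (m : ℕ) (h : HH G m) :
    th m (Pi.mulSingle 0 h) = Subgroup.inclusion (HH_mono (Nat.le_succ m)) h := by
  have key : ∀ y, (th m (Pi.mulSingle 0 h)).1.perm y = h.1.perm y ∧
      (th m (Pi.mulSingle 0 h)).1.fn y = h.1.fn y := by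
    intro y
    by_cases hy : y ∈ W (m + 1)
    · rw [th_perm, thf_mem _ hy, th_fn _ _ hy]
      by_cases h0 : y m = 0
      · have : y.erase m = y := Finsupp.erase_of_notMem_support (by simpa using h0)
        rw [h0, this]; simp
      · have h1 : y ∉ W m := fun h => h0 (h m le_rfl)
        rw [Pi.mulSingle_eq_of_ne h0, (h.2 y h1).1, (h.2 y h1).2]
        exact ⟨Finsupp.erase_add_single _ _, rfl⟩
    · have h1 : y ∉ W m := fun h => hy (W_mono (Nat.le_succ m) h)
      have h2 := (th m (Pi.mulSingle 0 h)).2 y hy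
      have h3 := h.2 y h1
      rw [h2.1, h2.2, h3.1, h3.2]
      exact ⟨rfl, rfl⟩
  exact Subtype.ext (Wr.ext (Equiv.ext fun y => (key y).1) (funext fun y => (key y).2))

open Classical in
noncomputable def tp (m : ℕ) : Equiv.Perm YY where
  toFun y := if y ∈ W (m + 1) then y - Finsupp.single m 1 else y
  invFun y := if y ∈ W (m + 1) then y + Finsupp.single m 1 else y
  left_inv y := by
    by_cases hy : y ∈ W (m + 1)
    · have : y - Finsupp.single m 1 ∈ W (m + 1) := by
        intro i hi
        rw [Finsupp.sub_apply, hy i hi, Finsupp.single_eq_of_ne (by omega), sub_zero]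
      simp only [if_pos hy, if_pos this, sub_add_cancel]
    · simp only [if_neg hy]
  right_inv y := by
    by_cases hy : y ∈ W (m + 1)
    · have : y + Finsupp.single m 1 ∈ W (m + 1) := by
        intro i hi
        rw [Finsupp.add_apply, hy i hi, Finsupp.single_eq_of_ne (by omega), add_zero]
      simp only [if_pos hy, if_pos this, add_sub_cancel_right]
    · simp only [if_neg hy]

lemma tp_mem {m : ℕ} {y : YY} (hy : y ∈ W (m + 1)) : tp m y = y - Finsupp.single m 1 := if_pos hy
lemma tp_symm_mem {m : ℕ} {y : YY} (hy : y ∈ W (m + 1)) :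
    (tp m).symm y = y + Finsupp.single m 1 := if_pos hy
lemma tp_not {m : ℕ} {y : YY} (hy : y ∉ W (m + 1)) : tp m y = y := if_neg hy

noncomputable def tt (m : ℕ) : HH G (m + 1) := ⟨pp (tp m), fun _ hy => ⟨tp_not hy, rfl⟩⟩

lemma pp_mem {m : ℕ} {σ : Equiv.Perm YY} (h : ∀ y, y ∉ W m → σ y = y) : pp σ ∈ HH G m :=
  fun y hy => ⟨h y hy, rfl⟩

lemma sub_single_mem {m : ℕ} {y : YY} (hy : y ∈ W (m + 1)) (k : ℤ) :
    y - Finsupp.single m k ∈ W (m + 1) := by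
  intro i hi
  rw [Finsupp.sub_apply, hy i hi, Finsupp.single_eq_of_ne (by omega), sub_zero]

lemma th_shift (m : ℕ) (s : ℤ → HH G m) : tt m * th m s = th m (fun k => s (k + 1)) * tt m := by
  refine Subtype.ext (Wr.ext (Equiv.ext fun y => ?_) (funext fun y => ?_))
  · show tp m (thf m s y) = thf m (fun k => s (k + 1)) (tp m y)
    by_cases hy : y ∈ W (m + 1)
    · have h1 := perm_mem_W (s (y m)).2 (erase_mem hy)
      rw [tp_mem hy, thf_mem _ hy, tp_mem (add_single_mem h1 _), thf_mem _ (sub_single_mem hy _)]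
      have e1 : (y - Finsupp.single m 1 : YY) m = y m - 1 := by simp
      have e2 : (y - Finsupp.single m 1 : YY).erase m = y.erase m := by
        ext i
        rcases eq_or_ne i m with rfl | h
        · simp
        · simp [Finsupp.erase_ne h]
      rw [e1, e2, sub_add_cancel, Finsupp.single_sub]
      abel
    · rw [tp_not hy]
      simp only [thf, if_neg hy]
      exact tp_not hy
  · show 1 * (th m s).1.fn ((tp m).symm y) = (th m fun k => s (k + 1)).1.fn y * 1
    rw [one_mul, mul_one]
    by_cases hy : y ∈ W (m + 1)
    · have h2 : y + Finsupp.single m 1 ∈ W (m + 1) := by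
        simpa using sub_single_mem hy (-1)
      rw [tp_symm_mem hy, th_fn _ _ h2, th_fn _ _ hy]
      have e1 : (y + Finsupp.single m 1 : YY) m = y m + 1 := by simp
      have e2 : (y + Finsupp.single m 1 : YY).erase m = y.erase m := by
        ext i
        rcases eq_or_ne i m with rfl | h
        · simp
        · simp [Finsupp.erase_ne h]
      rw [e1, e2]
    · have : (tp m).symm y = y := if_neg hy
      rw [this, ((th m s).2 y hy).2, ((th m _).2 y hy).2]

lemma HH_mit (m : ℕ) : Mit (Subgroup.inclusion (HH_mono (G := G) (Nat.le_succ m))) := by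
  let ph : HH G m →* (ℤ → HH G m) := MonoidHom.mk' (fun h k => if 1 ≤ k then h else 1) (by
    intro a b; funext k
    by_cases hk : 1 ≤ k
    · simp only [Pi.mul_apply, if_pos hk]
    · simp only [Pi.mul_apply, if_neg hk, one_mul])
  have hph : ∀ h k, ph h k = if 1 ≤ k then h else 1 := fun _ _ => rfl
  refine ⟨(th m).comp ph, tt m, ?_, ?_⟩
  · intro h h'
    rw [← th_single]
    have hc : Commute (Pi.mulSingle 0 h : ℤ → HH G m) (ph h') := by
      funext k
      rw [Pi.mul_apply, Pi.mul_apply, hph]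
      rcases eq_or_ne k 0 with rfl | hk
      · simp
      · simp [Pi.mulSingle_eq_of_ne hk]
    exact hc.map (th m)
  · intro h
    rw [← th_single, MonoidHom.comp_apply, th_shift, mul_inv_cancel_right, ← map_mul]
    congr 1
    funext k
    rw [Pi.mul_apply, hph, hph]
    rcases eq_or_ne k 0 with rfl | hk
    · simp
    · have : 1 ≤ k + 1 ↔ 1 ≤ k := by omega
      simp [Pi.mulSingle_eq_of_ne hk, this]

lemma HH_chain (r m : ℕ) : Chain (EE G) r (HH G m) (Subgroup.inclusion (HH_le_EE m)) := by
  induction r generalizing m with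
  | zero => trivial
  | succ r ih => exact ⟨HH G (m + 1), inferInstance, _, _, rfl, HH_mit m, ih (m + 1)⟩

lemma EE_binate : Binate (EE G) := by
  intro F
  have : ∃ m, ∀ x ∈ F, x.1 ∈ HH G m := by
    classical
    induction F using Finset.induction_on with
    | empty => exact ⟨0, by simp⟩
    | insert a F _ ih =>
      obtain ⟨m, hm⟩ := ih
      obtain ⟨n, hn⟩ := a.2
      refine ⟨max m n, fun x hx => ?_⟩
      rcases Finset.mem_insert.1 hx with rfl | hx
      · exact HH_mono (le_max_right _ _) hn
      · exact HH_mono (le_max_left _ _) (hm x hx)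
  obtain ⟨m, hm⟩ := this
  exact ⟨HH G m, inferInstance, _, Subgroup.inclusion_injective (HH_le_EE m),
    fun x hx => ⟨⟨x.1, hm x hx⟩, rfl⟩, HH_chain 4 m⟩

end E2

end Rz


open CategoryTheory AlgebraicTopology

namespace Rz

section NNdef
variable {Y G : Type} [Group G]

def NN (E : Subgroup (Wr Y G)) : Subgroup E where
  carrier := {e | e.1.perm = 1 ∧ (Function.mulSupport e.1.fn).Finite}
  one_mem' := ⟨rfl, by
    have : Function.mulSupport (1 : Wr Y G).fn = ∅ := Function.mulSupport_eq_empty_iff.2 rfl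
    show (Function.mulSupport (1 : Wr Y G).fn).Finite
    rw [this]; exact Set.finite_empty⟩
  mul_mem' := by
    rintro a b ⟨ha, ha'⟩ ⟨hb, hb'⟩
    refine ⟨?_, (ha'.union hb').subset ?_⟩
    · show a.1.perm * b.1.perm = 1
      rw [ha, hb, one_mul]
    · intro y hy
      by_contra h
      rw [Set.mem_union, not_or, Function.notMem_mulSupport, Function.notMem_mulSupport] at h
      apply hy
      show a.1.fn y * b.1.fn (a.1.perm.symm y) = 1
      rw [ha, h.1, one_mul]
      exact h.2
  inv_mem' := by
    rintro a ⟨ha, ha'⟩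
    refine ⟨?_, ha'.subset ?_⟩
    · show a.1.perm⁻¹ = 1
      rw [ha, inv_one]
    · intro y hy h
      apply hy
      show (a.1.fn (a.1.perm y))⁻¹ = 1
      rw [ha]
      simpa using h

lemma mem_NN {E : Subgroup (Wr Y G)} {e : E} :
  e ∈ NN E ↔ e.1.perm = 1 ∧ (Function.mulSupport e.1.fn).Finite := Iff.rfl

instance (E : Subgroup (Wr Y G)) : (NN E).Normal := ⟨by
  rintro n ⟨hn, hn'⟩ e
  refine ⟨?_, (hn'.image e.1.perm).subset ?_⟩
  · show e.1.perm * n.1.perm * e.1.perm⁻¹ = 1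
    rw [hn]; group
  · intro y hy
    refine ⟨e.1.perm.symm y, fun h => hy ?_, by simp⟩
    show e.1.fn y * n.1.fn (e.1.perm.symm y) *
      (e.1.fn (e.1.perm ((e.1.perm * n.1.perm).symm y)))⁻¹ = 1
    rw [h, hn, mul_one, mul_one, Equiv.apply_symm_apply, mul_inv_cancel]⟩

lemma fx_conj {η : Equiv.Perm Y} {a : Wr Y G} {y : Y} (h : Fx a (η.symm y)) :
    Fx (pp η * a * (pp η)⁻¹) y := by
  refine ⟨?_, ?_⟩
  · show η (a.perm (η.symm y)) = y
    rw [h.1, Equiv.apply_symm_apply]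
  · show 1 * a.fn (η.symm y) * 1⁻¹ = 1
    rw [h.2]; simp

end NNdef

lemma perm_map {Y : Type} [Countable Y] (U V : Set Y) (h1 : U.Infinite) (h2 : Uᶜ.Infinite)
    (h3 : V.Infinite) (h4 : Vᶜ.Infinite) : ∃ k : Equiv.Perm Y, ∀ y, y ∈ U ↔ k y ∈ V := by
  classical
  have := h1.to_subtype
  have := h2.to_subtype
  have := h3.to_subtype
  have := h4.to_subtype
  obtain ⟨e⟩ := nonempty_equiv_of_countable (α := U) (β := V)
  obtain ⟨f⟩ := nonempty_equiv_of_countable (α := ↥(Uᶜ)) (β := ↥(Vᶜ))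
  refine ⟨((Equiv.Set.sumCompl U).symm.trans (e.sumCongr f)).trans (Equiv.Set.sumCompl V), ?_⟩
  intro y
  by_cases hy : y ∈ U
  · simp [Equiv.Set.sumCompl_symm_apply_of_mem hy, hy]
  · simp only [hy, false_iff]
    simp only [Equiv.trans_apply, Equiv.Set.sumCompl_symm_apply_of_notMem hy,
      Equiv.sumCongr_apply, Sum.map_inr, Equiv.Set.sumCompl_apply_inr]
    exact (f ⟨y, hy⟩).2

section E2
variable {G : Type} [Group G]

instance : Infinite (W 1) := by
  refine Infinite.of_injective (fun k : ℕ => (⟨Finsupp.single 0 (k : ℤ), ?_⟩ : W 1)) ?_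
  · intro i hi
    rw [Finsupp.single_eq_of_ne (by omega)]
  · intro k l h
    have := DFunLike.congr_fun (congrArg Subtype.val h) 0
    simpa using this

lemma EE_top_of {K : Subgroup (EE G)} [K.Normal] (h : ∀ m, ∃ η : Equiv.Perm YY, ∃ k ∈ K,
    k.1 = pp η ∧ ∀ w ∈ W (m + 1), η w ∉ W (m + 1)) : K = ⊤ := by
  rw [eq_top_iff, ← A1.perfect (EE_binate (G := G)).a1, commutator_def, Subgroup.commutator_le]
  rintro ⟨a, m, ha⟩ - ⟨b, n, hb⟩ -
  obtain ⟨η, k, hk, hkη, hη⟩ := h (max m n)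
  rw [commutatorElement_def]
  refine disp_comm K hk (Subtype.ext ?_)
  show (k.1 * a * k.1⁻¹) * b = b * (k.1 * a * k.1⁻¹)
  rw [hkη]
  refine comm_of_fx fun y => ?_
  by_cases hy : y ∈ W (max m n + 1)
  · left
    refine fx_conj (HH_mono (by omega) ha _ (fun h' => hη _ h' ?_))
    rwa [Equiv.apply_symm_apply]
  · right
    exact HH_mono (by omega) hb _ hy

open Classical in
lemma exists_disp (σ : Equiv.Perm (W 1)) (P : Set (W 1)) (hP : P.Infinite)
    (hσ : ∀ x ∈ P, σ x ∉ P) (m : ℕ) : ∃ k : Equiv.Perm YY, (∀ y, y ∉ W (m + 2) → k y = y) ∧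
      ∀ w ∈ W (m + 1), (k * Equiv.Perm.ofSubtype σ * k⁻¹) w ∉ W (m + 1) := by
  have hle : W 1 ⊆ W (m + 2) := W_mono (by omega)
  let i : W 1 → W (m + 2) := Set.inclusion hle
  have hi : Function.Injective i := Set.inclusion_injective hle
  obtain ⟨k, hk⟩ := perm_map (i '' P) {d : W (m + 2) | d.1 ∈ W (m + 1)} (hP.image hi.injOn)
    (by
      have : (i '' (σ '' P)).Infinite := (hP.image σ.injective.injOn).image hi.injOn
      refine this.mono ?_
      rintro _ ⟨_, ⟨x, hx, rfl⟩, rfl⟩ ⟨x', hx', e⟩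
      rw [hi e] at hx'
      exact hσ x hx hx')
    (by
      refine Set.infinite_of_injective_forall_mem (f := i) hi ?_
      intro x
      exact W_mono (by omega) x.2)
    (by
      refine Set.infinite_of_injective_forall_mem (f := fun k : ℕ =>
        (⟨Finsupp.single (m + 1) ((k : ℤ) + 1), ?_⟩ : W (m + 2))) ?_ ?_
      · intro i hi
        rw [Finsupp.single_eq_of_ne (by omega)]
      · intro k l h
        have := DFunLike.congr_fun (congrArg Subtype.val h) (m + 1)
        simpa using this
      · intro k h
        have := h (m + 1) le_rfl
        simp only [Finsupp.single_eq_same] at this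
        omega)
  refine ⟨Equiv.Perm.ofSubtype k, fun y hy => Equiv.Perm.ofSubtype_apply_of_not_mem _ hy, ?_⟩
  intro w hw
  have hw2 : w ∈ W (m + 2) := W_mono (by omega) hw
  rw [Equiv.Perm.mul_apply, Equiv.Perm.mul_apply, ← map_inv,
    Equiv.Perm.ofSubtype_apply_of_mem _ hw2]
  obtain ⟨x, hx, hxe⟩ := (hk (k⁻¹ ⟨w, hw2⟩)).2 (by simpa using hw)
  rw [← hxe]
  have e1 : Equiv.Perm.ofSubtype σ (i x).1 = (i (σ x)).1 := Equiv.Perm.ofSubtype_apply_coe σ x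
  rw [e1, Equiv.Perm.ofSubtype_apply_coe]
  intro h
  obtain ⟨x', hx', e'⟩ := (hk _).2 h
  rw [hi e'] at hx'
  exact hσ x hx hx'

lemma EE_GG (n : ℕ) (hn : 2 ≤ n) : GG (EE G ⧸ NN (EE G)) n := by
  classical
  obtain ⟨σ, h1, h2, P, hP, hσ⟩ := free_perm (W 1) n hn
  let q := QuotientGroup.mk' (NN (EE G))
  let g : EE G := ⟨pp (Equiv.Perm.ofSubtype σ), 1,
    pp_mem fun y hy => Equiv.Perm.ofSubtype_apply_of_not_mem _ hy⟩
  have hg : ∀ k, (g ^ k).1.perm = Equiv.Perm.ofSubtype (σ ^ k) := by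
    intro k
    show (pp (Equiv.Perm.ofSubtype σ) ^ k : Wr YY G).perm = _
    rw [← map_pow, ← map_pow]; rfl
  refine ⟨q g, orderOf_eq_of _ _ ?_ ?_, ?_⟩
  · rw [← map_pow]
    have : g ^ n = 1 := by
      apply Subtype.ext
      show (pp (Equiv.Perm.ofSubtype σ) ^ n : Wr YY G) = 1
      rw [← map_pow, ← map_pow, h1, map_one, map_one]
    rw [this, map_one]
  · intro k hk h
    rw [← map_pow] at h
    have h3 := ((QuotientGroup.eq_one_iff _).1 h).1
    rw [hg] at h3
    have h4 : σ ^ k = 1 := Equiv.Perm.ofSubtype_injective (h3.trans (map_one _).symm)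
    obtain ⟨x⟩ : Nonempty (W 1) := inferInstance
    exact h2 k hk x (by rw [h4]; rfl)
  · intro K hK hgK
    have : (K.comap q).Normal := hK.comap q
    have hT : K.comap q = ⊤ := by
      refine EE_top_of fun m => ?_
      obtain ⟨k, hk1, hk2⟩ := exists_disp σ P hP hσ m
      let k' : EE G := ⟨pp k, m + 2, pp_mem hk1⟩
      refine ⟨_, k' * g * k'⁻¹, this.conj_mem g hgK k', ?_, hk2⟩
      show pp k * pp (Equiv.Perm.ofSubtype σ) * (pp k)⁻¹ = _
      rw [map_mul, map_mul, map_inv]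
    rw [eq_top_iff]
    rintro x -
    obtain ⟨y, rfl⟩ := QuotientGroup.mk'_surjective (NN (EE G)) x
    exact (hT ▸ Subgroup.mem_top y : y ∈ K.comap q)

lemma EE_norep : NoRep (EE G) := by
  intro V _ _ _ ρ
  have key : ∀ m (a b : HH G m), Commute (ρ (Subgroup.inclusion (HH_le_EE m) a))
      (ρ (Subgroup.inclusion (HH_le_EE m) b)) := by
    intro m a b
    let ψ : (ℤ → HH G m) →* LinearMap.GeneralLinearGroup ℂ V :=
      (ρ.comp (Subgroup.inclusion (HH_le_EE (m + 1)))).comp (th m)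
    let T := ρ (Subgroup.inclusion (HH_le_EE (m + 1)) (tt m))
    have hψ : ∀ s, T * ψ s = ψ (fun k => s (k + 1)) * T := by
      intro s
      simp only [T, ψ, MonoidHom.comp_apply, ← map_mul, th_shift]
    have hs : ∀ (i : ℕ) (x : HH G m), T * ψ (Pi.mulSingle ((i : ℤ) + 1) x) * T⁻¹ =
        ψ (Pi.mulSingle (i : ℤ) x) := by
      intro i x
      rw [hψ, mul_inv_cancel_right]
      congr 1
      funext k
      rcases eq_or_ne k i with rfl | h
      · simp
      · rw [Pi.mulSingle_eq_of_ne h, Pi.mulSingle_eq_of_ne (by omega)]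
    have h0 : ∀ x, ψ (Pi.mulSingle 0 x) = ρ (Subgroup.inclusion (HH_le_EE m) x) := by
      intro x
      simp only [ψ, MonoidHom.comp_apply, th_single]
      rfl
    obtain ⟨i, hi⟩ := rep_comm (fun i => ψ (Pi.mulSingle (i : ℤ) a))
      (fun i => ψ (Pi.mulSingle (i : ℤ) b)) (by
        intro i j hij
        have : Commute (Pi.mulSingle (j : ℤ) a : ℤ → HH G m) (Pi.mulSingle (i : ℤ) b) :=
          Pi.mulSingle_commute (by omega) _ _
        exact this.map ψ)
    have hd : ∀ i : ℕ, Commute (ψ (Pi.mulSingle (i : ℤ) a)) (ψ (Pi.mulSingle (i : ℤ) b)) →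
        Commute (ψ (Pi.mulSingle 0 a)) (ψ (Pi.mulSingle 0 b)) := by
      intro i
      induction i with
      | zero => intro h; exact h
      | succ i ih =>
        intro h
        apply ih
        rw [← hs, ← hs]
        push_cast at h
        rw [Commute.conj_iff]
        exact h
    have := hd i hi
    rwa [h0, h0] at this
  have hle : commutator (EE G) ≤ ρ.ker := by
    rw [commutator_def, Subgroup.commutator_le]
    rintro ⟨a, m, ha⟩ - ⟨b, n, hb⟩ -
    have h := key (max m n) ⟨a, HH_mono (le_max_left _ _) ha⟩ ⟨b, HH_mono (le_max_right _ _) hb⟩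
    rw [MonoidHom.mem_ker, map_commutatorElement, commutatorElement_eq_one_iff_commute]
    exact h
  rw [A1.perfect (EE_binate (G := G)).a1] at hle
  exact fun s => MonoidHom.mem_ker.1 (hle (Subgroup.mem_top s))

lemma NoRep.quot {E Q : Type} [Group E] [Group Q] {π : E →* Q} (hπ : Function.Surjective π)
    (h : NoRep E) : NoRep Q := by
  intro V _ _ _ ρ s
  obtain ⟨e, rfl⟩ := hπ s
  exact h V (ρ.comp π) e

open Classical in
lemma swap_mem_EE (y y' : YY) : pp (Equiv.swap y y') ∈ EE G := by
  obtain ⟨m, hm⟩ := exists_W y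
  obtain ⟨n, hn⟩ := exists_W y'
  refine ⟨max m n, pp_mem fun z hz => Equiv.swap_apply_of_ne_of_ne ?_ ?_⟩
  · rintro rfl; exact hz (W_mono (le_max_left _ _) hm)
  · rintro rfl; exact hz (W_mono (le_max_right _ _) hn)

lemma fin_mem_EE (f : YY → G) (hf : (Function.mulSupport f).Finite) : (⟨1, f⟩ : Wr YY G) ∈ EE G := by
  have : ∃ m, ∀ y ∈ Function.mulSupport f, y ∈ W m := by
    refine hf.induction_on (motive := fun S _ => ∃ m, ∀ y ∈ S, y ∈ W m) _ ⟨0, by simp⟩ ?_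
    · rintro a S _ _ ⟨m, hm⟩
      obtain ⟨n, hn⟩ := exists_W a
      refine ⟨max m n, ?_⟩
      rintro y (rfl | hy)
      · exact W_mono (le_max_right _ _) hn
      · exact W_mono (le_max_left _ _) (hm y hy)
  obtain ⟨m, hm⟩ := this
  exact ⟨m, fun y hy => ⟨rfl, by by_contra h; exact hy (hm y h)⟩⟩

lemma EE_center (x : EE G ⧸ NN (EE G)) (h : ∀ y, Commute x y) : x = 1 := by
  classical
  obtain ⟨x, rfl⟩ := QuotientGroup.mk'_surjective (NN (EE G)) x
  have hx : ∀ e : EE G, x * e * x⁻¹ * e⁻¹ ∈ NN (EE G) := by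
    intro e
    rw [← QuotientGroup.eq_one_iff]
    have := h (QuotientGroup.mk' (NN (EE G)) e)
    show (QuotientGroup.mk' (NN (EE G))) (x * e * x⁻¹ * e⁻¹) = 1
    simp only [map_mul, map_inv]
    rw [this.eq]; group
  have hσ : x.1.perm = 1 := by
    ext1 y
    by_contra hy
    rw [Equiv.Perm.one_apply] at hy
    obtain ⟨z, hz⟩ := Infinite.exists_notMem_finset ({y, x.1.perm y} : Finset YY)
    simp only [Finset.mem_insert, Finset.mem_singleton, not_or] at hz
    have h1 := (hx ⟨_, swap_mem_EE y z⟩).1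
    have h2 : x.1.perm * Equiv.swap y z * x.1.perm⁻¹ * (Equiv.swap y z)⁻¹ = 1 := h1
    rw [mul_inv_eq_one, mul_inv_eq_iff_eq_mul] at h2
    have h3 := Equiv.congr_fun h2 y
    rw [Equiv.Perm.mul_apply, Equiv.Perm.mul_apply, Equiv.swap_apply_left,
      Equiv.swap_apply_of_ne_of_ne hy (Ne.symm hz.2)] at h3
    exact hz.1 (x.1.perm.injective h3)
  obtain ⟨m, hm⟩ := x.2
  have hfin := (hx ⟨(tt m).1, m + 1, (tt m).2⟩).2
  rw [QuotientGroup.mk'_apply, QuotientGroup.eq_one_iff]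
  refine ⟨hσ, hfin.subset ?_⟩
  intro y hy
  have hyW : y ∈ W m := by
    by_contra h'
    exact hy (hm y h').2
  have hyW1 : y ∈ W (m + 1) := W_mono (by omega) hyW
  rw [Function.mem_mulSupport] at hy ⊢
  have e1 : (x.1 * (tt m).1 * x.1⁻¹ * (tt m).1⁻¹).fn y = x.1.fn y * (x.1.fn ((tp m).symm y))⁻¹ := by
    simp only [Wr.mul_fn, Wr.mul_perm, Wr.inv_fn, Wr.inv_perm, hσ]
    show x.1.fn y * 1 * _ * 1⁻¹ = _
    rw [mul_one, inv_one, mul_one]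
    rfl
  have e2 : x.1.fn ((tp m).symm y) = 1 := by
    refine (hm _ ?_).2
    rw [tp_symm_mem hyW1]
    intro h'
    have := h' m le_rfl
    rw [Finsupp.add_apply, hyW m le_rfl] at this
    simp at this
  show (x.1 * (tt m).1 * x.1⁻¹ * (tt m).1⁻¹).fn y ≠ 1
  rw [e1, e2, inv_one, mul_one]
  exact hy

end E2

end Rz


open CategoryTheory AlgebraicTopology

namespace Rz

section FSdef

def FS (Y Γ : Type) [Group Γ] : Subgroup (Y → Γ) where
  carrier := {l | (Function.mulSupport l).Finite}
  one_mem' := by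
    show (Function.mulSupport (1 : Y → Γ)).Finite
    rw [Function.mulSupport_one]; exact Set.finite_empty
  mul_mem' := fun {a b} ha hb => (Set.Finite.union ha hb).subset (Function.mulSupport_mul a b)
  inv_mem' := fun {a} ha => by
    show (Function.mulSupport a⁻¹).Finite
    rw [Function.mulSupport_inv]; exact ha

variable {Y Γ : Type} [Group Γ]

lemma mem_FS {l : Y → Γ} : l ∈ FS Y Γ ↔ (Function.mulSupport l).Finite := Iff.rfl

open Classical in
noncomputable def fext (Y0 : Finset Y) {H : Type} [Group H] (α : H →* Γ) : (Y0 → H) →* FS Y Γ :=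
  MonoidHom.mk' (fun h => ⟨fun y => if hy : y ∈ Y0 then α (h ⟨y, hy⟩) else 1,
    Y0.finite_toSet.subset (by
      intro y hy
      by_contra h'
      exact hy (dif_neg h'))⟩) (by
    intro a b
    apply Subtype.ext
    funext y
    show (if hy : y ∈ Y0 then α ((a * b) ⟨y, hy⟩) else 1) =
      (if hy : y ∈ Y0 then α (a ⟨y, hy⟩) else 1) * (if hy : y ∈ Y0 then α (b ⟨y, hy⟩) else 1)
    by_cases hy : y ∈ Y0
    · simp only [dif_pos hy, Pi.mul_apply, map_mul]
    · simp only [dif_neg hy, mul_one])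

open Classical in
lemma fext_apply (Y0 : Finset Y) {H : Type} [Group H] (α : H →* Γ) (h : Y0 → H) (y : Y) :
    (fext Y0 α h).1 y = if hy : y ∈ Y0 then α (h ⟨y, hy⟩) else 1 := rfl

lemma fext_mem (Y0 : Finset Y) {H : Type} [Group H] (α : H →* Γ) (h : Y0 → H) (y : Y0) :
    (fext Y0 α h).1 y.1 = α (h y) := dif_pos y.2

lemma fext_chain (Y0 : Finset Y) (r : ℕ) {H : Type} [Group H] (α : H →* Γ) (h : Chain Γ r H α) :
    Chain (FS Y Γ) r (Y0 → H) (fext Y0 α) := by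
  induction r generalizing H with
  | zero => trivial
  | succ r ih =>
    obtain ⟨K, _, ι, β, rfl, ⟨φ, t, h1, h2⟩, hc⟩ := h
    refine ⟨Y0 → K, inferInstance, ι.compLeft Y0, fext Y0 β, ?_, ⟨φ.compLeft Y0, fun _ => t, ?_, ?_⟩,
      ih β hc⟩
    · rfl
    · intro a b
      funext y
      exact h1 (a y) (b y)
    · intro a
      funext y
      exact h2 (a y)

lemma FS_binate (h : Binate Γ) : Binate (FS Y Γ) := by
  classical
  intro F
  let Y0 : Finset Y := F.biUnion (fun l => (mem_FS.1 l.2).toFinset)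
  let F' : Finset Γ := F.biUnion (fun l => Y0.image l.1)
  obtain ⟨H, _, α, hi, hF, hc⟩ := h F'
  refine ⟨Y0 → H, inferInstance, fext Y0 α, ?_, ?_, fext_chain Y0 4 α hc⟩
  · intro a b e
    funext y
    apply hi
    rw [← fext_mem Y0 α a y, ← fext_mem Y0 α b y, e]
  · intro l hl
    have : ∀ y : Y0, ∃ h, α h = l.1 y.1 := fun y => hF _ (by
      simp only [F', Finset.mem_biUnion, Finset.mem_image]
      exact ⟨l, hl, y.1, y.2, rfl⟩)
    choose a ha using this
    refine ⟨a, Subtype.ext (funext fun y => ?_)⟩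
    by_cases hy : y ∈ Y0
    · rw [fext_mem Y0 α a ⟨y, hy⟩, ha]
    · rw [fext_apply, dif_neg hy]
      by_contra h'
      apply hy
      simp only [Y0, Finset.mem_biUnion, Set.Finite.mem_toFinset]
      exact ⟨l, hl, fun e => h' e.symm⟩

variable {G : Type} [Group G] {E : Subgroup (Wr Y G)}
  (hfin : ∀ f : Y → G, (Function.mulSupport f).Finite → (⟨1, f⟩ : Wr Y G) ∈ E)

def nf (f : Y → G) (hf : (Function.mulSupport f).Finite) : E := ⟨⟨1, f⟩, hfin f hf⟩

lemma nf_mem (f : Y → G) (hf : (Function.mulSupport f).Finite) : nf hfin f hf ∈ NN E := ⟨rfl, hf⟩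

def pL (π : Γ →* G) : FS Y Γ →* NN E := MonoidHom.mk'
  (fun l => ⟨nf hfin (fun y => π (l.1 y)) ((mem_FS.1 l.2).subset (by
    intro y hy h
    exact hy ((congrArg π h).trans (map_one π)))), nf_mem hfin _ _⟩) (by
  intro a b
  refine Subtype.ext (Subtype.ext (Wr.ext rfl (funext fun y => ?_)))
  exact map_mul π (a.1 y) (b.1 y))

lemma pL_perm (π : Γ →* G) (l : FS Y Γ) : (pL hfin π l).1.1.perm = 1 := rfl
lemma pL_fn (π : Γ →* G) (l : FS Y Γ) (y : Y) : (pL hfin π l).1.1.fn y = π (l.1 y) := rfl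

def secL (sec : G → Γ) (s1 : sec 1 = 1) (n : E) (hn : n ∈ NN E) : FS Y Γ :=
  ⟨fun y => sec (n.1.fn y), hn.2.subset (by
    intro y hy h
    exact hy ((congrArg sec h).trans s1))⟩

lemma pL_secL (π : Γ →* G) {sec : G → Γ} (hs : ∀ x, π (sec x) = x) (s1 : sec 1 = 1) (n : E)
    (hn : n ∈ NN E) : pL hfin π (secL sec s1 n hn) = ⟨n, hn⟩ :=
  Subtype.ext (Subtype.ext (Wr.ext hn.1.symm (funext fun _ => hs _)))

lemma NN_A1 (hfin : ∀ f : Y → G, (Function.mulSupport f).Finite → (⟨1, f⟩ : Wr Y G) ∈ E)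
    {π : Γ →* G} {sec : G → Γ} (hs : ∀ x, π (sec x) = x) (s1 : sec 1 = 1)
    (h : Binate Γ) : A1 (NN E) :=
  A1.quot (π := pL hfin π) (fun n => ⟨_, pL_secL hfin π hs s1 n.1 n.2⟩) (FS_binate h).a1

end FSdef

end Rz


open CategoryTheory AlgebraicTopology

namespace Rz

section Gam
variable {Y G C : Type} [Group G] [AddCommGroup C] {E : Subgroup (Wr Y G)}

def ch (κ : G → G → C) (a b : Wr Y G) (y : Y) : C := κ (a.fn y) (b.fn (a.perm.symm y))

lemma ch_coc {κ : G → G → C} (hκ : Coc2 κ) (a b c : Wr Y G) (y : Y) :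
    ch κ b c (a.perm.symm y) - ch κ (a * b) c y + ch κ a (b * c) y - ch κ a b y = 0 :=
  hκ (a.fn y) (b.fn (a.perm.symm y)) (c.fn (b.perm.symm (a.perm.symm y)))

lemma eqN {a b : E} (h : (QuotientGroup.mk' (NN E)) a = QuotientGroup.mk' (NN E) b) :
    a.1.perm = b.1.perm ∧ {y | a.1.fn y ≠ b.1.fn y}.Finite := by
  have h1 : a * b⁻¹ ∈ NN E := by
    rw [← QuotientGroup.eq_one_iff]
    show (QuotientGroup.mk' (NN E)) (a * b⁻¹) = 1
    rw [map_mul, map_inv, h, mul_inv_cancel]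
  have h2 : a.1.perm * b.1.perm⁻¹ = 1 := h1.1
  have h3 := mul_inv_eq_one.1 h2
  refine ⟨h3, h1.2.subset fun y hy h' => hy ?_⟩
  have h4 : a.1.fn y * (b.1.fn (b.1.perm (a.1.perm.symm y)))⁻¹ = 1 := h'
  rw [h3, Equiv.apply_symm_apply] at h4
  exact mul_inv_eq_one.1 h4

variable (κ : G → G → C) (s : E ⧸ NN E → E)

def RR (a b : E) (y : Y) : C := ch κ a.1 b.1 y - ch κ (s a).1 (s b).1 y

noncomputable def gam (a b : E) : C := ∑ᶠ y, RR κ s a b y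

def Zf (a b c : E ⧸ NN E) (y : Y) : C :=
  - (ch κ (s b).1 (s c).1 ((s a).1.perm.symm y) - ch κ (s (a * b)).1 (s c).1 y
    + ch κ (s a).1 (s (b * c)).1 y - ch κ (s a).1 (s b).1 y)

noncomputable def kap3 (a b c : E ⧸ NN E) : C := ∑ᶠ y, Zf κ s a b c y

variable {κ s} (hs : ∀ x, QuotientGroup.mk' (NN E) (s x) = x)

lemma RR_fin (hs : ∀ x, QuotientGroup.mk' (NN E) (s x) = x)
    (a b : E) : (Function.support (RR κ s a b)).Finite := by
  obtain ⟨h1, h2⟩ := eqN (hs a).symm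
  obtain ⟨h3, h4⟩ := eqN (hs b).symm
  refine (h2.union (h4.image a.1.perm)).subset ?_
  intro y hy
  by_contra h
  rw [Set.mem_union, not_or] at h
  apply hy
  have e1 : a.1.fn y = (s a).1.fn y := by
    by_contra h'; exact h.1 h'
  have e2 : b.1.fn (a.1.perm.symm y) = (s b).1.fn (a.1.perm.symm y) := by
    by_contra h'; exact h.2 ⟨_, h', by simp⟩
  show κ _ _ - κ _ _ = 0
  rw [← h1, e1, e2, sub_self]

lemma RR_coc (hs : ∀ x, QuotientGroup.mk' (NN E) (s x) = x)
    (hκ : Coc2 κ) (a b c : E) (y : Y) :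
    RR κ s b c (a.1.perm.symm y) - RR κ s (a * b) c y + RR κ s a (b * c) y - RR κ s a b y
      = Zf κ s a b c y := by
  obtain ⟨h1, -⟩ := eqN (hs a).symm
  have e := ch_coc hκ a.1 b.1 c.1 y
  simp only [RR, Zf]
  rw [← h1]
  have e1 : ch κ (a * b : E).1 c.1 y = ch κ (a.1 * b.1) c.1 y := rfl
  have e2 : ch κ a.1 (b * c : E).1 y = ch κ a.1 (b.1 * c.1) y := rfl
  have e3 : ((a * b : E) : E ⧸ NN E) = (a : E ⧸ NN E) * b := rfl
  have e4 : ((b * c : E) : E ⧸ NN E) = (b : E ⧸ NN E) * c := rfl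
  rw [e1, e2, e3, e4]
  linear_combination (norm := abel) e

lemma finsum4 {f1 f2 f3 f4 : Y → C} (h1 : (Function.support f1).Finite)
    (h2 : (Function.support f2).Finite) (h3 : (Function.support f3).Finite)
    (h4 : (Function.support f4).Finite) : ∑ᶠ y, (f1 y - f2 y + f3 y - f4 y) =
      ∑ᶠ y, f1 y - ∑ᶠ y, f2 y + ∑ᶠ y, f3 y - ∑ᶠ y, f4 y := by
  have h12 : (Function.support fun y => f1 y - f2 y).Finite :=
    (h1.union h2).subset (Function.support_sub f1 f2)
  have h123 : (Function.support fun y => f1 y - f2 y + f3 y).Finite :=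
    (h12.union h3).subset (Function.support_add (fun y => f1 y - f2 y) f3)
  rw [finsum_sub_distrib h123 h4, finsum_add_distrib h12 h3, finsum_sub_distrib h1 h2]

lemma gam_coc (hs : ∀ x, QuotientGroup.mk' (NN E) (s x) = x)
    (hκ : Coc2 κ) (a b c : E) :
    kap3 κ s a b c = gam κ s b c - gam κ s (a * b) c + gam κ s a (b * c) - gam κ s a b := by
  have e1 : gam κ s b c = ∑ᶠ y, RR κ s b c (a.1.perm.symm y) :=
    (finsum_comp_equiv a.1.perm.symm).symm
  rw [e1]
  have hf : (Function.support fun y => RR κ s b c (a.1.perm.symm y)).Finite := by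
    refine ((RR_fin (κ := κ) hs b c).image a.1.perm).subset ?_
    intro y hy
    exact ⟨_, hy, by simp⟩
  simp only [gam]
  rw [← finsum4 hf (RR_fin hs _ _) (RR_fin hs _ _) (RR_fin hs _ _)]
  exact finsum_congr fun y => (RR_coc hs hκ a b c y).symm

lemma kap3_coc (hs : ∀ x, QuotientGroup.mk' (NN E) (s x) = x)
    (hκ : Coc2 κ) : Coc3 (kap3 κ s) := by
  intro x y z w
  obtain ⟨x, rfl⟩ := QuotientGroup.mk'_surjective (NN E) x
  obtain ⟨y, rfl⟩ := QuotientGroup.mk'_surjective (NN E) y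
  obtain ⟨z, rfl⟩ := QuotientGroup.mk'_surjective (NN E) z
  obtain ⟨w, rfl⟩ := QuotientGroup.mk'_surjective (NN E) w
  rw [← map_mul, ← map_mul, ← map_mul]
  simp only [QuotientGroup.mk'_apply]
  rw [gam_coc hs hκ, gam_coc hs hκ, gam_coc hs hκ, gam_coc hs hκ, gam_coc hs hκ]
  simp only [mul_assoc]
  abel

variable (s1 : s 1 = 1) (k1 : ∀ g, κ 1 g = 0) (k2 : ∀ g, κ g 1 = 0)

lemma kap3_norm (s1 : s 1 = 1) (k1 : ∀ g, κ 1 g = 0) (k2 : ∀ g, κ g 1 = 0)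
    (a b : E ⧸ NN E) :
    kap3 κ s 1 a b = 0 ∧ kap3 κ s a 1 b = 0 ∧ kap3 κ s a b 1 = 0 := by
  have c1 : ∀ (x : Wr Y G) y, ch κ 1 x y = 0 := fun x y => k1 _
  have c2 : ∀ (x : Wr Y G) y, ch κ x 1 y = 0 := fun x y => k2 _
  have e1 : ((1 : E) : Wr Y G) = 1 := rfl
  refine ⟨?_, ?_, ?_⟩
  · have : ∀ y, Zf κ s 1 a b y = 0 := by
      intro y
      simp only [Zf, one_mul, s1, e1, c1, Wr.one_perm]
      have : (1 : Equiv.Perm Y).symm y = y := rfl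
      rw [this]; abel
    simp only [kap3, this, finsum_zero]
  · have : ∀ y, Zf κ s a 1 b y = 0 := by
      intro y
      simp only [Zf, one_mul, mul_one, s1, e1, c1, c2]
      abel
    simp only [kap3, this, finsum_zero]
  · have : ∀ y, Zf κ s a b 1 y = 0 := by
      intro y
      simp only [Zf, mul_one, s1, e1, c2]
      abel
    simp only [kap3, this, finsum_zero]

lemma gam_NN (s1 : s 1 = 1) (k1 : ∀ g, κ 1 g = 0)
    {n : E} (hn : n ∈ NN E) (n' : E) :
    gam κ s n n' = ∑ᶠ y, κ (n.1.fn y) (n'.1.fn y) := by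
  have e1 : (n : E ⧸ NN E) = 1 := (QuotientGroup.eq_one_iff n).2 hn
  refine finsum_congr fun y => ?_
  simp only [RR, ch, e1, s1]
  rw [hn.1]
  have : ((1 : E) : Wr Y G).fn y = 1 := rfl
  rw [this, k1, sub_zero]
  rfl

end Gam

end Rz


open CategoryTheory AlgebraicTopology

namespace Rz

section Main
variable {Y Γ G C : Type} [Group Γ] [Group G] [AddCommGroup C] {E : Subgroup (Wr Y G)}

def jL (j : Multiplicative C →* Γ) (d : Y →₀ C) : FS Y Γ :=
  ⟨fun y => j (Multiplicative.ofAdd (d y)), d.hasFiniteSupport.subset (by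
    intro y hy h
    exact hy ((congrArg (fun c => j (Multiplicative.ofAdd c)) h).trans (map_one j)))⟩

lemma jL_add (j : Multiplicative C →* Γ) (d d' : Y →₀ C) : jL j (d + d') = jL j d * jL j d' :=
  Subtype.ext (funext fun y => map_mul j (Multiplicative.ofAdd (d y)) (Multiplicative.ofAdd (d' y)))

def actL (τ : Equiv.Perm Y) : FS Y Γ →* FS Y Γ := MonoidHom.mk'
  (fun l => ⟨fun y => l.1 (τ.symm y), ((mem_FS.1 l.2).image τ).subset (by
    intro y hy
    exact ⟨τ.symm y, hy, by simp⟩)⟩) (fun _ _ => rfl)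

lemma conj_aux {M : Type} [AddCommGroup M] {E : Type} [Group E] {g : E → E → M} {τ n n' m m' : E}
    (h1 : g n n' - g (τ * n) n' + g τ (n * n') - g τ n = 0)
    (h2 : g τ n' - g (m * τ) n' + g m (τ * n') - g m τ = 0)
    (h3 : g m' τ - g (m * m') τ + g m (m' * τ) - g m m' = 0)
    (e : τ * n = m * τ) (e' : τ * n' = m' * τ) :
    g m m' = g n n' + (g τ (n * n') - g (m * m') τ) - (g τ n - g m τ) - (g τ n' - g m' τ) := by
  rw [e] at h1
  rw [e'] at h2
  linear_combination (norm := abel) -h1 + h2 - h3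

open Classical in
lemma core (hfin : ∀ f : Y → G, (Function.mulSupport f).Finite → (⟨1, f⟩ : Wr Y G) ∈ E)
    (hswap : ∀ y y' : Y, pp (Equiv.swap y y') ∈ E) (y0 : Y)
    {π : Γ →* G} (j : Multiplicative C →* Γ) (hπj : ∀ b, π (j b) = 1)
    (hB : Binate Γ) {sec : G → Γ} (hsec : ∀ x, π (sec x) = x) (sec1 : sec 1 = 1) {κ : G → G → C}
    (hκ : ∀ x y, sec x * sec y = j (Multiplicative.ofAdd (κ x y)) * sec (x * y))
    (k1 : ∀ x, κ 1 x = 0)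
    {f : E ⧸ NN E → E ⧸ NN E → E ⧸ NN E → TT}
    (f1 : ∀ x y, f 1 x y = 0) (f2 : ∀ x y, f x 1 y = 0) (f3 : ∀ x y, f x y 1 = 0)
    {g : E → E → TT}
    (hg : ∀ x y z : E, f x y z = g y z - g (x * y) z + g x (y * z) - g x y) :
    ∃ (c : C →+ TT) (u : E → TT), ∀ n n', n ∈ NN E → n' ∈ NN E →
      g n n' + c (∑ᶠ y, κ (n.1.fn y) (n'.1.fn y)) = u n + u n' - u (n * n') := by
  have q1 : ∀ n : E, n ∈ NN E → (n : E ⧸ NN E) = 1 := fun n hn => (QuotientGroup.eq_one_iff n).2 hn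
  let P : FS Y Γ →* NN E := pL hfin π
  have qP : ∀ l, ((P l).1 : E ⧸ NN E) = 1 := fun l => q1 _ (P l).2
  let gL : FS Y Γ → FS Y Γ → TT := fun l l' => g (P l).1 (P l').1
  have hgL : Coc2 gL := by
    intro x y z
    have := hg (P x).1 (P y).1 (P z).1
    rw [qP, f1] at this
    simp only [gL, map_mul]
    exact this.symm
  obtain ⟨u, hu⟩ := (FS_binate (Y := Y) hB).a2 gL hgL
  have PjL : ∀ d, P (jL j d) = 1 := fun d =>
    Subtype.ext (Subtype.ext (Wr.ext rfl (funext fun y => hπj _)))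
  have hu1 : gL 1 1 = u 1 := by rw [hu, mul_one]; abel
  have hu2 : ∀ d l, u (jL j d * l) = u (jL j d) + u l - u 1 := by
    intro d l
    have e1 := hu (jL j d) l
    have e2 : gL (jL j d) l = gL 1 l := by simp only [gL, PjL, map_one]
    rw [e2, hgL.one_left, hu1] at e1
    rw [e1]; abel
  let μ : (Y →₀ C) →+ TT := AddMonoidHom.mk' (fun d => u (jL j d) - u 1) (by
    intro d d'
    rw [jL_add, hu2]; abel)
  have hμ : ∀ d, μ d = u (jL j d) - u 1 := fun _ => rfl
  have hsw : ∀ y c, μ (Finsupp.single y c) = μ (Finsupp.single y0 c) := by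
    intro y c
    let τ : E := ⟨pp (Equiv.swap y0 y), hswap _ _⟩
    let act : FS Y Γ →* FS Y Γ := actL (Equiv.swap y0 y)
    have hact : ∀ l, τ * (P l).1 = (P (act l)).1 * τ := by
      intro l
      refine Subtype.ext (Wr.ext ?_ (funext fun z => ?_))
      · show Equiv.swap y0 y * 1 = 1 * Equiv.swap y0 y
        rw [mul_one, one_mul]
      · show 1 * π (l.1 _) = π (l.1 _) * 1
        rw [mul_one, one_mul]
        rfl
    let w : FS Y Γ → TT := fun l => g τ (P l).1 - g (P (act l)).1 τ
    have hc : Coc1 (fun l => u (act l) - u l + w l) := by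
      intro l l'
      have h1 := hg τ (P l).1 (P l').1
      rw [qP, f2] at h1
      have h2 := hg (P (act l)).1 τ (P l').1
      rw [qP, f1] at h2
      have h3 := hg (P (act l)).1 (P (act l')).1 τ
      rw [qP, f1] at h3
      have h4 := conj_aux h1.symm h2.symm h3.symm (hact l) (hact l')
      have h5 := hu l l'
      have h6 := hu (act l) (act l')
      simp only [gL] at h5 h6
      rw [h5, h6] at h4
      have h7 : w (l * l') = g τ ((P l).1 * (P l').1) - g ((P (act l)).1 * (P (act l')).1) τ := by
        simp only [w, map_mul, Subgroup.coe_mul]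
      simp only [h7, map_mul]
      simp only [w]
      linear_combination (norm := abel) -h4
    have hz := (FS_binate (Y := Y) hB).a1 _ hc
    have hz1 := hz 1
    have hzj := hz (jL j (Finsupp.single y0 c))
    have hw : w (jL j (Finsupp.single y0 c)) = w 1 := by
      have : P (act (jL j (Finsupp.single y0 c))) = 1 :=
        Subtype.ext (Subtype.ext (Wr.ext rfl (funext fun y => hπj _)))
      simp only [w, this, PjL, map_one]
    have ha : act (jL j (Finsupp.single y0 c)) = jL j (Finsupp.single y c) := by
      refine Subtype.ext (funext fun z => ?_)
      show j (Multiplicative.ofAdd (Finsupp.single y0 c ((Equiv.swap y0 y).symm z))) =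
        j (Multiplicative.ofAdd (Finsupp.single y c z))
      congr 2
      rw [Equiv.symm_swap]
      by_cases h : z = y
      · subst h; simp
      · rw [Finsupp.single_eq_of_ne h, Finsupp.single_eq_of_ne]
        intro h'
        apply h
        have := congrArg (Equiv.swap y0 y) h'
        rwa [Equiv.swap_apply_self, Equiv.swap_apply_left] at this
    simp only [map_one] at hz1
    simp only [hw, ha] at hzj
    rw [hμ, hμ]
    linear_combination (norm := abel) hzj - hz1
  let c : C →+ TT := μ.comp (Finsupp.singleAddHom y0)
  have hc : ∀ d : Y →₀ C, μ d = c (∑ᶠ y, d y) := by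
    intro d
    have h1 : μ = c.comp (Finsupp.liftAddHom (fun _ => AddMonoidHom.id C)) := by
      refine Finsupp.addHom_ext fun y b => ?_
      rw [hsw]
      simp [c]
    have h2 : (Finsupp.liftAddHom (fun _ => AddMonoidHom.id C)) d = ∑ᶠ y, d y := by
      rw [finsum_eq_sum_of_support_subset (s := d.support) _ (by simp)]
      simp [Finsupp.sum]
    rw [← h2]
    exact DFunLike.congr_fun h1 d
  refine ⟨c, fun e => if h : e ∈ NN E then u (secL sec sec1 e h) else 0, ?_⟩
  intro n n' hn hn'
  simp only [dif_pos hn, dif_pos hn', dif_pos (mul_mem hn hn')]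
  let d : Y →₀ C := Finsupp.ofSupportFinite (fun y => κ (n.1.fn y) (n'.1.fn y)) (hn.2.subset (by
    intro y hy h
    apply hy
    show κ (n.1.fn y) _ = 0
    rw [h, k1]))
  have hd : ∀ y, d y = κ (n.1.fn y) (n'.1.fn y) := fun _ => rfl
  have e1 : secL sec sec1 n hn * secL sec sec1 n' hn' =
      jL j d * secL sec sec1 (n * n') (mul_mem hn hn') := by
    refine Subtype.ext (funext fun y => ?_)
    show sec (n.1.fn y) * sec (n'.1.fn y) = j (Multiplicative.ofAdd (κ (n.1.fn y) (n'.1.fn y))) *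
      sec (n.1.fn y * n'.1.fn (n.1.perm.symm y))
    rw [hn.1]
    exact hκ _ _
  have e2 := hu (secL sec sec1 n hn) (secL sec sec1 n' hn')
  rw [e1, hu2] at e2
  have e3 : gL (secL sec sec1 n hn) (secL sec sec1 n' hn') = g n n' := by
    simp only [gL, P, pL_secL hfin π hsec sec1]
  have e4 := hc d
  simp only [hd] at e4
  rw [e3] at e2
  rw [← e4, e2, hμ]
  abel

open Classical in
theorem U3_main (hfin : ∀ f : Y → G, (Function.mulSupport f).Finite → (⟨1, f⟩ : Wr Y G) ∈ E)
    (hswap : ∀ y y' : Y, pp (Equiv.swap y y') ∈ E) (y0 : Y)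
    {π : Γ →* G} (j : Multiplicative C →* Γ) (hj : ∀ b e, Commute (j b) e)
    (hker : ∀ e, π e = 1 ↔ ∃ b, j b = e) (hj1 : Function.Injective j)
    (hB : Binate Γ) {sec : G → Γ} (hsec : ∀ x, π (sec x) = x) (sec1 : sec 1 = 1)
    (a2 : A2 E) (a3 : A3 E) : ∃ κ3, U3 (E ⧸ NN E) C κ3 := by
  have hκ : ∀ x y, ∃ b : C, sec x * sec y = j (Multiplicative.ofAdd b) * sec (x * y) := by
    intro x y
    obtain ⟨b, hb⟩ := (hker (sec x * sec y * (sec (x * y))⁻¹)).1 (by simp [hsec])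
    exact ⟨Multiplicative.toAdd b, by rw [ofAdd_toAdd, hb]; group⟩
  choose κ hκ using hκ
  obtain ⟨c2, -, c4⟩ := central_u2 j hj hker hj1 hB.a1 hB.a2 sec hsec κ hκ
  have hj0 : ∀ b : C, j (Multiplicative.ofAdd b) = 1 → b = 0 := by
    intro b hb
    exact hj1 (hb.trans (map_one j).symm)
  have k1 : ∀ x, κ 1 x = 0 := by
    intro x
    apply hj0
    have := hκ 1 x
    rw [sec1, one_mul, one_mul] at this
    exact right_eq_mul.1 this
  have k2 : ∀ x, κ x 1 = 0 := by
    intro x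
    apply hj0
    have := hκ x 1
    rw [sec1, mul_one, mul_one] at this
    exact right_eq_mul.1 this
  have hπ := QuotientGroup.mk'_surjective (NN E)
  have hs0 : ∀ x : E ⧸ NN E, ∃ e : E, QuotientGroup.mk' (NN E) e = x ∧ (x = 1 → e = 1) := by
    intro x
    by_cases hx : x = 1
    · exact ⟨1, by rw [hx, map_one], fun _ => rfl⟩
    · obtain ⟨e, he⟩ := hπ x
      exact ⟨e, he, fun h => absurd h hx⟩
  choose s hs hs1 using hs0
  have s1 := hs1 1 rfl
  have hN : A1 (NN E) := NN_A1 hfin hsec sec1 hB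
  have hN' : A1 (QuotientGroup.mk' (NN E)).ker := by
    rw [QuotientGroup.ker_mk']; exact hN
  have hker' : ∀ n, QuotientGroup.mk' (NN E) n = 1 → n ∈ NN E :=
    fun n hn => (QuotientGroup.eq_one_iff n).1 hn
  refine ⟨kap3 κ s, kap3_coc hs c2, ?_, ?_⟩
  · intro f hf
    obtain ⟨f', hf', hff, f1, f2, f3⟩ := norm3 hf
    obtain ⟨g, hg⟩ := a3 _ (hf'.comp (QuotientGroup.mk' (NN E)))
    obtain ⟨c, u, hu⟩ := core hfin hswap y0 j (fun b => (hker _).2 ⟨b, rfl⟩) hB hsec sec1 hκ k1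
      f1 f2 f3 hg
    refine ⟨-c, ?_⟩
    have hn := fun a b => kap3_norm (E := E) (κ := κ) s1 k1 k2 a b
    have key : Cob3 (fun x y z => f' x y z + c (kap3 κ s x y z)) := by
      refine descent (π := QuotientGroup.mk' (NN E)) hπ (g := fun a b => g a b + c (gam κ s a b))
        (u := u) ?_ ?_ ?_ ?_ ?_ ?_
      · intro x y; simp only [f1, (hn x y).1, map_zero, add_zero]
      · intro x y; simp only [f2, (hn x y).2.1, map_zero, add_zero]
      · intro x y; simp only [f3, (hn x y).2.2, map_zero, add_zero]
      · intro x y z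
        have e1 := hg x y z
        have e2 := congrArg c (gam_coc hs c2 x y z)
        simp only [map_add, map_sub] at e2
        simp only [QuotientGroup.mk'_apply] at e1 ⊢
        rw [e1, e2]
        abel
      · intro n n' hnn hnn'
        show g n n' + c (gam κ s n n') = _
        rw [gam_NN s1 k1 (hker' n hnn)]
        exact hu n n' (hker' n hnn) (hker' n' hnn')
      · intro g' hg' kk1 kk2
        refine descent_comm_ker (f := fun x y z => f' x y z + c (kap3 κ s x y z)) hN' ?_ g' hg'
          kk1 kk2
        intro x y; simp only [f3, (hn x y).2.2, map_zero, add_zero]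
    obtain ⟨v, hv⟩ := hff
    obtain ⟨v', hv'⟩ := key
    refine ⟨fun a b => v a b + v' a b, fun x y z => ?_⟩
    have e1 := hv x y z
    have e2 := hv' x y z
    beta_reduce at e1 e2
    simp only [AddMonoidHom.neg_apply]
    linear_combination (norm := abel) e1 + e2
  · rintro c ⟨v, hv⟩
    let q := QuotientGroup.mk' (NN E)
    have hcoc : Coc2 (fun a b : E => c (gam κ s a b) - v (q a) (q b)) := by
      intro x y z
      have e1 := hv (q x) (q y) (q z)
      beta_reduce at e1
      have e2 := congrArg c (gam_coc hs c2 x y z)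
      simp only [map_add, map_sub] at e2
      simp only [map_mul]
      have e3 : c (kap3 κ s (q x) (q y) (q z)) = c (kap3 κ s x y z) := rfl
      rw [e3] at e1
      linear_combination (norm := abel) e1 - e2
    obtain ⟨w, hw⟩ := a2 _ hcoc
    have hsup : ∀ x : G, (Function.mulSupport (Pi.mulSingle y0 x : Y → G)).Finite := fun x =>
      (Set.finite_singleton y0).subset Pi.mulSupport_mulSingle_subset
    let i : G → E := fun x => nf hfin (Pi.mulSingle y0 x) (hsup x)
    have hiN : ∀ x, i x ∈ NN E := fun x => nf_mem hfin _ _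
    have hi : ∀ x y, i x * i y = i (x * y) := by
      intro x y
      refine Subtype.ext (Wr.ext rfl ?_)
      show (Pi.mulSingle y0 x * Pi.mulSingle y0 y : Y → G) = Pi.mulSingle y0 (x * y)
      exact (Pi.mulSingle_mul (f := fun _ : Y => G) y0 x y).symm
    apply c4
    refine ⟨fun x => w (i x) + v 1 1, fun x y => ?_⟩
    have e1 := hw (i x) (i y)
    beta_reduce at e1
    rw [gam_NN s1 k1 (hiN x), hi] at e1
    have e2 : ∑ᶠ z, κ ((i x).1.fn z) ((i y).1.fn z) = κ x y := by
      rw [finsum_eq_single _ y0]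
      · show κ ((Pi.mulSingle y0 x : Y → G) y0) ((Pi.mulSingle y0 y : Y → G) y0) = _
        rw [Pi.mulSingle_eq_same, Pi.mulSingle_eq_same]
      · intro z hz
        show κ ((Pi.mulSingle y0 x : Y → G) z) _ = _
        rw [Pi.mulSingle_eq_of_ne hz, k1]
    have e3 : ∀ x, q (i x) = 1 := fun x => (QuotientGroup.eq_one_iff _).2 (hiN x)
    rw [e2, e3, e3] at e1
    beta_reduce
    linear_combination (norm := abel) e1

end Main

end Rz


open CategoryTheory AlgebraicTopology

namespace Rz

theorem exists_K2 (C : Type) [AddCommGroup C] :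
    ∃ (Q : Type) (_ : Group Q) (κ3 : Q → Q → Q → C), A1 Q ∧ A2 Q ∧ U3 Q C κ3 ∧
      (∀ n ≥ 2, GG Q n) ∧ NoRep Q ∧ ∀ x : Q, (∀ y, Commute x y) → x = 1 := by
  obtain ⟨Γ, _, j, ι, hj1, hcen, hB, -, -⟩ := exists_gamma (Multiplicative C)
  have hj : ∀ b e, Commute (j b) e := fun b => (hcen _).2 ⟨b, rfl⟩
  have hN : j.range.Normal := ⟨by
    rintro _ ⟨b, rfl⟩ g
    rw [← (hj b g).eq, mul_inv_cancel_right]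
    exact ⟨b, rfl⟩⟩
  let π := QuotientGroup.mk' j.range
  have hker : ∀ e, π e = 1 ↔ ∃ b, j b = e := fun e => QuotientGroup.eq_one_iff e
  have hsec : ∃ sec : Γ ⧸ j.range → Γ, (∀ x, π (sec x) = x) ∧ sec 1 = 1 := by
    classical
    obtain ⟨s, hs⟩ := (QuotientGroup.mk'_surjective j.range).hasRightInverse
    refine ⟨fun x => if x = 1 then 1 else s x, fun x => ?_, if_pos rfl⟩
    by_cases hx : x = 1
    · simp [hx]
    · simp only [hx, if_false]; exact hs x
  obtain ⟨sec, hs, s1⟩ := hsec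
  let G := Γ ⧸ j.range
  have hq := QuotientGroup.mk'_surjective (NN (EE G))
  have hb : Binate (EE G) := EE_binate
  obtain ⟨κ3, h3⟩ := U3_main (E := EE G) fin_mem_EE
    (fun y y' => by convert swap_mem_EE (G := G) y y') 0 j hj hker hj1 hB hs s1 hb.a2 hb.a3
  refine ⟨EE G ⧸ NN (EE G), inferInstance, κ3, A1.quot hq hb.a1, A2.quot hq ?_ hb.a2, h3,
    fun n hn => EE_GG n hn, NoRep.quot hq EE_norep, EE_center⟩
  rw [QuotientGroup.ker_mk']
  exact NN_A1 fin_mem_EE hs s1 hB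

lemma prod_left {H K : Type} [Group H] [Group K] (hH : A1 H) {M : Subgroup (H × K)} (hM : M.Normal)
    {g : H × K} (hg : g ∈ M) (h : ∀ L : Subgroup H, L.Normal → g.1 ∈ L → L = ⊤) (x : H) :
    (x, (1 : K)) ∈ M := by
  have ht : M.map (MonoidHom.fst H K) = ⊤ :=
    h _ (hM.map _ Prod.fst_surjective) ⟨g, hg, rfl⟩
  have hle : commutator H ≤ M.comap (MonoidHom.inl H K) := by
    rw [commutator_def, Subgroup.commutator_le]
    intro a _ b _
    obtain ⟨⟨a', k⟩, hm, rfl⟩ : a ∈ M.map (MonoidHom.fst H K) := by rw [ht]; trivial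
    have e := M.mul_mem hm (hM.conj_mem _ (M.inv_mem hm) (b, 1))
    have : (a', k) * ((b, (1 : K)) * (a', k)⁻¹ * (b, 1)⁻¹) = (a' * b * a'⁻¹ * b⁻¹, 1) := by
      ext
      · simp [mul_assoc]
      · simp
    rw [this] at e
    exact e
  rw [hH.perfect] at hle
  exact hle (Subgroup.mem_top x)

lemma prod_right {H K : Type} [Group H] [Group K] (hK : A1 K) {M : Subgroup (H × K)} (hM : M.Normal)
    {g : H × K} (hg : g ∈ M) (h : ∀ L : Subgroup K, L.Normal → g.2 ∈ L → L = ⊤) (x : K) :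
    ((1 : H), x) ∈ M := by
  have := prod_left (H := K) (K := H) hK
    (M := M.comap (MulEquiv.prodComm (M := K) (N := H)).toMonoidHom) (hM.comap _)
    (g := (g.2, g.1)) hg h x
  exact this

lemma prod_STG {H K : Type} [Group H] [Group K] (hH : A1 H) (hK : A1 K)
    (h1 : ∀ n ≥ 2, GG H n) (h2 : ∀ n ≥ 2, GG K n) : StronglyTorsionGenerated (H × K) := by
  intro n hn
  obtain ⟨a, ha, ha'⟩ := h1 n hn
  obtain ⟨b, hb, hb'⟩ := h2 n hn
  refine ⟨(a, b), by rw [Prod.orderOf]; simp [ha, hb], ?_⟩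
  have hg : (a, b) ∈ Subgroup.normalClosure {(a, b)} :=
    Subgroup.subset_normalClosure (Set.mem_singleton _)
  rw [eq_top_iff]
  rintro ⟨x, y⟩ -
  have := Subgroup.mul_mem _ (prod_left hH Subgroup.normalClosure_normal hg ha' x)
    (prod_right hK Subgroup.normalClosure_normal hg hb' y)
  simpa using this

lemma prod_center {H K : Type} [Group H] [Group K] (hK : ∀ x : K, (∀ y, Commute x y) → x = 1) :
    Nonempty (Subgroup.center (H × K) ≃* Subgroup.center H) := by
  have key : ∀ s : H × K, s ∈ Subgroup.center (H × K) ↔ s.1 ∈ Subgroup.center H ∧ s.2 = 1 := by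
    rintro ⟨x, y⟩
    simp only [Subgroup.mem_center_iff]
    constructor
    · intro h
      exact ⟨fun g => congrArg Prod.fst (h (g, 1)),
        hK _ fun z => (congrArg Prod.snd (h (1, z))).symm⟩
    · rintro ⟨h, rfl⟩ ⟨a, b⟩
      exact Prod.ext (h a) (by simp)
  exact ⟨{ toFun := fun s => ⟨s.1.1, ((key _).1 s.2).1⟩
           invFun := fun x => ⟨(x.1, 1), (key _).2 ⟨x.2, rfl⟩⟩
           left_inv := fun s => Subtype.ext (Prod.ext rfl ((key _).1 s.2).2.symm)
           right_inv := fun _ => rfl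
           map_mul' := fun _ _ => rfl }⟩

lemma NoRep.prod {H K : Type} [Group H] [Group K] (h1 : NoRep H) (h2 : NoRep K) :
    NoRep (H × K) := by
  intro V _ _ _ ρ s
  have e1 := h1 V (ρ.comp (MonoidHom.inl H K)) s.1
  have e2 := h2 V (ρ.comp (MonoidHom.inr H K)) s.2
  have e : s = MonoidHom.inl H K s.1 * MonoidHom.inr H K s.2 := by ext <;> simp
  rw [e, map_mul]
  simp only [MonoidHom.comp_apply] at e1 e2
  rw [e1, e2, mul_one]

end Rz

theorem realization_with_no_nontrivial_representations
    (A B C : Type) [AddCommGroup A] [AddCommGroup B] [AddCommGroup C] :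
    ∃ (S : Type) (_ : Group S),
      StronglyTorsionGenerated S ∧
      Nonempty (Subgroup.center S ≃* Multiplicative A) ∧
      Subsingleton (grpHomology S 1) ∧
      Nonempty (grpHomology S 2 ≃+ B) ∧
      Nonempty (grpHomology S 3 ≃+ C) ∧
      (∀ (V : Type) [AddCommGroup V] [Module ℂ V] [FiniteDimensional ℂ V]
        (ρ : S →* LinearMap.GeneralLinearGroup ℂ V) (s : S), ρ s = 1) := by
  obtain ⟨K, _, κ, k1, k3, ku, ⟨kc⟩, kg, kr⟩ := Rz.exists_K1 A B
  obtain ⟨Q, _, κ3, q1, q2, qu, qg, qr, qc⟩ := Rz.exists_K2 C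
  obtain ⟨c⟩ := Rz.prod_center (H := K) qc
  exact ⟨K × Q, inferInstance, Rz.prod_STG k1 q1 kg qg, ⟨c.trans kc⟩, (Rz.A1.prod k1 q1).grp,
    (Rz.A1.prodU2 k1 q2 ku).grp, (Rz.A1.prodU3 q1 q2 k3 qu).grp, Rz.NoRep.prod kr qr⟩
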